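/- Consider sequences n, p = p(n), D = D(n) with n + 1 < p ≤ D and p/n → γ ∈ (1, ∞) as n → ∞. In the Gaussian linear regression setting, let x₀ = x₀^{(D)} ∈ ℝ^D be a sequence of deterministic test vectors such that ‖x₀,ₚ‖²/p converges to a positive limit, and suppose the test point is not a training point (m = 0), so that ŷ₀ = x₀,ₚᵀ Xₚ† y with all n rows of X drawn i.i.d. N(0, I_D). Define σ₀² := (n/p)·(1/D + (1 + σ² − p/D)/(p − n − 1))·‖x₀,ₚ‖². Then the law of ŷ₀/σ₀ converges weakly to the standard normal distribution N(0,1) as n → ∞; that is, ŷ₀ conditioned on m = 0 and x₀ is asymptotically Gaussian with mean 0 and variance σ₀². -/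

import Mathlib

open MeasureTheory ProbabilityTheory Matrix Filter Topology
open scoped NNReal ENNReal

open Classical in
/-- The Moore–Penrose pseudoinverse of a real matrix, characterized by the four
Penrose equations (which determine it uniquely when a solution exists, as it
always does over `ℝ`). -/
noncomputable def pinv {m n : ℕ} (A : Matrix (Fin m) (Fin n) ℝ) : Matrix (Fin n) (Fin m) ℝ :=
  if h : ∃ B : Matrix (Fin n) (Fin m) ℝ,
      A * B * A = A ∧ B * A * B = B ∧ (A * B)ᵀ = A * B ∧ (B * A)ᵀ = B * A
  then h.choose else 0

/-- The law of a vector of `k` i.i.d. standard Gaussian entries. -/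
noncomputable def stdGaussianVec (k : ℕ) : Measure (Fin k → ℝ) :=
  Measure.pi fun _ => gaussianReal 0 1

/-- The law of an `n × D` random matrix with i.i.d. standard Gaussian entries. -/
noncomputable def stdGaussianMatrix (n D : ℕ) : Measure (Fin n → Fin D → ℝ) :=
  Measure.pi fun _ => stdGaussianVec D
/-- The random coefficient vector `β ∼ N(0, (1/D)·I_D)`, modeled as `β = b/√D`
for a standard Gaussian vector `b`. -/
noncomputable def coeffs (D : ℕ) (b : Fin D → ℝ) : Fin D → ℝ := fun j => b j / Real.sqrt D

/-- The `n × p` submatrix of the first `p` columns of an `n × D` matrix. -/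
def firstCols (n p D : ℕ) (hpD : p ≤ D) (Xe : Fin n → Fin D → ℝ) :
    Matrix (Fin n) (Fin p) ℝ :=
  Matrix.of fun i j => Xe i (Fin.castLE hpD j)

/-- The prediction `ŷ₀ = x₀,ₚᵀ Xₚ† y` of the min-norm least squares interpolator at
a test point `x₀`, as a function of the sample `ω = (X entries, b, e)` where the
coefficients are `β = b/√D`, the noise is `ε = σe`, and `yᵢ = xᵢᵀβ + εᵢ`. -/
noncomputable def minNormPrediction (σ : ℝ) (n p D : ℕ) (hpD : p ≤ D) (x₀ : Fin D → ℝ)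
    (ω : (Fin n → Fin D → ℝ) × (Fin D → ℝ) × (Fin n → ℝ)) : ℝ :=
  ∑ j : Fin p, x₀ (Fin.castLE hpD j) *
    (pinv (firstCols n p D hpD ω.1) *ᵥ
      (fun i => (∑ jd, ω.1 i jd * coeffs D ω.2.1 jd) + σ * ω.2.2 i)) j

instance instProbGV (k : ℕ) : IsProbabilityMeasure (stdGaussianVec k) := by
  unfold stdGaussianVec; infer_instance

instance instProbGM (n k : ℕ) : IsProbabilityMeasure (stdGaussianMatrix n k) := by
  unfold stdGaussianMatrix; infer_instance

lemma gv_charFun (k : ℕ) (t : Fin k → ℝ) :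
    ∫ x, Complex.exp ((t ⬝ᵥ x : ℝ) * Complex.I) ∂(stdGaussianVec k)
      = Complex.exp (-((t ⬝ᵥ t : ℝ) : ℂ) / 2) := by
  have h := charFun_pi (μ := fun _ : Fin k => gaussianReal 0 1) (WithLp.toLp 2 t)
  have h2 : charFun ((Measure.pi fun _ : Fin k => gaussianReal 0 1).map (WithLp.toLp 2))
      (WithLp.toLp 2 t) = ∫ x, Complex.exp ((t ⬝ᵥ x : ℝ) * Complex.I) ∂(stdGaussianVec k) := by
    rw [charFun, ← MeasurableEquiv.coe_toLp, integral_map_equiv]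
    refine integral_congr_ae (ae_of_all _ fun x => ?_)
    simp [PiLp.inner_apply, dotProduct]
  rw [← h2, h]
  simp only [charFun_gaussianReal]
  rw [← Complex.exp_sum]
  congr 1
  simp [dotProduct, Finset.sum_div, Finset.sum_neg_distrib, neg_div, pow_two]

lemma gv_rot (k : ℕ) (O : Matrix (Fin k) (Fin k) ℝ) (hO : O * Oᵀ = 1) :
    MeasurePreserving (fun x => O *ᵥ x) (stdGaussianVec k) (stdGaussianVec k) := by
  have hm : Measurable (fun x : Fin k → ℝ => O *ᵥ x) := by
    refine Continuous.measurable ?_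
    fun_prop
  refine ⟨hm, ?_⟩
  have : IsProbabilityMeasure ((stdGaussianVec k).map (fun x => O *ᵥ x)) :=
    Measure.isProbabilityMeasure_map hm.aemeasurable
  refine (charFun_eq_pi_iff (E := fun _ : Fin k => ℝ)
    (μ := fun _ : Fin k => gaussianReal 0 1)).1 ?_
  intro t
  rw [← charFun_pi]
  simp only [charFun, ← MeasurableEquiv.coe_toLp, integral_map_equiv]
  rw [integral_map hm.aemeasurable (by
    refine Continuous.aestronglyMeasurable ?_
    simp only [MeasurableEquiv.coe_toLp]
    fun_prop)]
  have e1 := gv_charFun k (Oᵀ *ᵥ t.ofLp)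
  have e2 := gv_charFun k (t.ofLp)
  have e3 : (Oᵀ *ᵥ t.ofLp) ⬝ᵥ (Oᵀ *ᵥ t.ofLp) = t.ofLp ⬝ᵥ t.ofLp := by
    rw [dotProduct_mulVec, vecMul_transpose, mulVec_mulVec, hO, one_mulVec]
  rw [e3, ← e2] at e1
  have key : ∀ x : Fin k → ℝ, (Oᵀ *ᵥ t.ofLp) ⬝ᵥ x = t.ofLp ⬝ᵥ (O *ᵥ x) := by
    intro x
    rw [dotProduct_mulVec, ← mulVec_transpose]
  simp only [key] at e1
  unfold stdGaussianVec at e1 ⊢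
  convert e1 using 1 <;>
  · refine integral_congr_ae (ae_of_all _ fun x => ?_)
    simp [PiLp.inner_apply, dotProduct, mul_comm]

lemma gv_dot (k : ℕ) (c : Fin k → ℝ) :
    MeasurePreserving (fun x => c ⬝ᵥ x) (stdGaussianVec k)
      (gaussianReal 0 (c ⬝ᵥ c).toNNReal) := by
  have hm : Measurable (fun x : Fin k → ℝ => c ⬝ᵥ x) := by
    refine Continuous.measurable ?_
    fun_prop
  refine ⟨hm, ?_⟩
  have : IsProbabilityMeasure ((stdGaussianVec k).map (fun x => c ⬝ᵥ x)) :=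
    Measure.isProbabilityMeasure_map hm.aemeasurable
  refine Measure.ext_of_charFun (funext fun t => ?_)
  rw [charFun_gaussianReal, charFun, integral_map hm.aemeasurable (by
    refine Continuous.aestronglyMeasurable ?_
    fun_prop)]
  have e1 := gv_charFun k (t • c)
  have h0 : 0 ≤ c ⬝ᵥ c := by simpa using dotProduct_star_self_nonneg c
  convert e1 using 1
  · refine integral_congr_ae (ae_of_all _ fun x => ?_)
    simp [mul_comm]
  · simp [Real.coe_toNNReal _ h0]
    ring_nf

lemma gm_transpose (n p : ℕ) :
    MeasurePreserving (fun (X : Fin n → Fin p → ℝ) j i => X i j)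
      (stdGaussianMatrix n p) (stdGaussianMatrix p n) := by
  have hm : Measurable (fun (X : Fin n → Fin p → ℝ) (j : Fin p) (i : Fin n) => X i j) := by
    fun_prop
  refine ⟨hm, ?_⟩
  have c1 := Measure.infinitePi_map_curry (fun (_ : Fin n) (_ : Fin p) => gaussianReal 0 1)
  have c2 := Measure.infinitePi_map_curry (fun (_ : Fin p) (_ : Fin n) => gaussianReal 0 1)
  simp only [Measure.infinitePi_eq_pi] at c1 c2
  have c3 := (measurePreserving_piCongrLeft (α := fun _ : Fin p × Fin n => ℝ)
    (fun _ => gaussianReal 0 1) (Equiv.prodComm (Fin n) (Fin p))).map_eq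
  unfold stdGaussianMatrix stdGaussianVec
  rw [← c1, ← c2, ← c3, Measure.map_map (by fun_prop) (by fun_prop),
    Measure.map_map (by fun_prop) (by fun_prop)]
  congr 1

lemma gm_rot_right (n p : ℕ) (O : Matrix (Fin p) (Fin p) ℝ) (hO : O * Oᵀ = 1) :
    MeasurePreserving (fun (X : Fin n → Fin p → ℝ) i => O *ᵥ X i)
      (stdGaussianMatrix n p) (stdGaussianMatrix n p) :=
  measurePreserving_pi _ _ (fun _ => gv_rot p O hO)

lemma gm_rot_left (n p : ℕ) (O : Matrix (Fin n) (Fin n) ℝ) (hO : O * Oᵀ = 1) :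
    MeasurePreserving (fun (X : Fin n → Fin p → ℝ) i j => ∑ k, O i k * X k j)
      (stdGaussianMatrix n p) (stdGaussianMatrix n p) :=
  ((gm_transpose p n).comp (gm_rot_right p n O hO)).comp (gm_transpose n p)

lemma exists_rot (k : ℕ) (x y : Fin k → ℝ) (h : x ⬝ᵥ x = y ⬝ᵥ y) :
    ∃ O : Matrix (Fin k) (Fin k) ℝ, O * Oᵀ = 1 ∧ Oᵀ * O = 1 ∧ O *ᵥ x = y := by
  set d := x - y with hd
  by_cases h0 : d ⬝ᵥ d = 0
  · have : d = 0 := dotProduct_self_eq_zero.1 h0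
    exact ⟨1, by simp, by simp, by simpa [hd, sub_eq_zero] using this⟩
  · set O : Matrix (Fin k) (Fin k) ℝ := 1 - (2 / (d ⬝ᵥ d)) • vecMulVec d d with hO
    have hT : Oᵀ = O := by
      simp [hO, transpose_vecMulVec]
    have hOO : O * O = 1 := by
      simp only [hO, sub_mul, mul_sub, one_mul, mul_one, smul_mul_assoc, mul_smul_comm,
        vecMulVec_mul_vecMulVec]
      ext i j
      simp [vecMulVec_apply]
      field_simp
      ring
    refine ⟨O, by rw [hT, hOO], by rw [hT, hOO], ?_⟩
    have hdx : d ⬝ᵥ d = 2 * (d ⬝ᵥ x) := by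
      simp only [hd, sub_dotProduct, dotProduct_sub, h, dotProduct_comm y x]
      ring
    ext i
    simp only [hO, sub_mulVec, one_mulVec, smul_mulVec, vecMulVec_mulVec]
    have : d ⬝ᵥ x ≠ 0 := fun h' => h0 (by rw [hdx, h', mul_zero])
    simp [hdx]
    field_simp
    simp [hd]

noncomputable def vC : ℝ := Var[fun x : ℝ => x ^ 2; gaussianReal 0 1]

lemma vC_nonneg : 0 ≤ vC := variance_nonneg _ _

lemma memLp_sq_gauss : MemLp (fun x : ℝ => x ^ 2) 2 (gaussianReal 0 1) := by
  have h := memLp_id_gaussianReal' (μ := 0) (v := 1) 4 (by simp)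
  have := h.norm_rpow_div (2 : ℝ≥0∞)
  have h42 : (4 : ℝ≥0∞) / 2 = 2 := by
    rw [show (4 : ℝ≥0∞) = 2 * 2 by norm_num, ENNReal.mul_div_cancel_right (by simp) (by simp)]
  rw [h42] at this
  convert this using 2
  simp

lemma integral_sq_gauss : ∫ x : ℝ, x ^ 2 ∂(gaussianReal 0 1) = 1 := by
  have h := variance_fun_id_gaussianReal (μ := 0) (v := 1)
  rw [variance_eq_integral (by fun_prop)] at h
  simpa using h

lemma gv_diag (k : ℕ) (l : Fin k → ℝ) {ε : ℝ} (hε : 0 < ε) :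
    stdGaussianVec k {x | ε ≤ |∑ i, l i * x i ^ 2 - ∑ i, l i|} ≤
      ENNReal.ofReal (vC * (∑ i, l i ^ 2) / ε ^ 2) := by
  have hi : ∀ i : Fin k, MemLp (fun x : ℝ => l i * x ^ 2) 2 (gaussianReal 0 1) :=
    fun i => memLp_sq_gauss.const_mul (l i)
  have hv := variance_sum_pi (μ := fun _ : Fin k => gaussianReal 0 1) hi
  have hmi : ∀ i : Fin k, MemLp (fun x : Fin k → ℝ => l i * x i ^ 2) 2
      (Measure.pi fun _ : Fin k => gaussianReal 0 1) := fun i =>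
    (hi i).comp_measurePreserving (measurePreserving_eval _ i)
  have hm : MemLp (∑ i, fun x : Fin k → ℝ => l i * x i ^ 2) 2
      (Measure.pi fun _ : Fin k => gaussianReal 0 1) := memLp_finsetSum' _ (fun i _ => hmi i)
  have hE : ∫ x, (∑ i, fun x : Fin k → ℝ => l i * x i ^ 2) x
      ∂(Measure.pi fun _ : Fin k => gaussianReal 0 1) = ∑ i, l i := by
    simp only [Finset.sum_apply]
    rw [integral_finsetSum _ (fun i _ => (hmi i).integrable (by norm_num))]
    refine Finset.sum_congr rfl fun i _ => ?_
    have h2 := integral_map (μ := Measure.pi fun _ : Fin k => gaussianReal 0 1)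
      (φ := fun x : Fin k → ℝ => x i) (f := fun y : ℝ => l i * y ^ 2) (measurable_pi_apply i).aemeasurable
      (by refine Continuous.aestronglyMeasurable ?_; fun_prop)
    have h3 := (measurePreserving_eval (fun _ : Fin k => gaussianReal 0 1) i).map_eq
    rw [show (fun x : Fin k → ℝ => x i) = Function.eval i from rfl, h3] at h2
    refine h2.symm.trans ?_
    rw [integral_const_mul, integral_sq_gauss, mul_one]
  have := meas_ge_le_variance_div_sq hm hε
  rw [hE, hv] at this
  unfold stdGaussianVec
  refine (le_of_eq ?_).trans (this.trans (le_of_eq ?_))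
  · congr 1; ext x; simp
  · congr 2
    rw [Finset.mul_sum]
    refine Finset.sum_congr rfl fun i _ => ?_
    rw [variance_const_mul, vC, mul_comm]

lemma gv_quad (k : ℕ) (M : Matrix (Fin k) (Fin k) ℝ) (hT : Mᵀ = M) (hM : M * M = M)
    {ε : ℝ} (hε : 0 < ε) :
    stdGaussianVec k {x | ε ≤ |x ⬝ᵥ (M *ᵥ x) - M.trace|} ≤
      ENNReal.ofReal (vC * M.trace / ε ^ 2) := by
  have hH : M.IsHermitian := by
    rw [IsHermitian, conjTranspose_eq_transpose_of_trivial, hT]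
  have hs := hH.spectral_theorem
  set U : Matrix (Fin k) (Fin k) ℝ := (hH.eigenvectorUnitary).1 with hU
  set l := hH.eigenvalues with hl
  have hU1 : U * Uᵀ = 1 := by
    have := Unitary.coe_mul_star_self hH.eigenvectorUnitary
    rwa [Unitary.coe_star, star_eq_conjTranspose, conjTranspose_eq_transpose_of_trivial] at this
  have hU2 : Uᵀ * U = 1 := by
    have := Unitary.coe_star_mul_self hH.eigenvectorUnitary
    rwa [star_eq_conjTranspose, conjTranspose_eq_transpose_of_trivial] at this
  have hs' : M = U * diagonal l * Uᵀ := by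
    conv_lhs => rw [hs]
    rw [Unitary.conjStarAlgAut_apply]
    rw [star_eq_conjTranspose, conjTranspose_eq_transpose_of_trivial]
    rfl
  have htr : M.trace = ∑ i, l i := by
    rw [hs', trace_mul_comm, ← mul_assoc, hU2, one_mul, trace_diagonal]
  have htr2 : M.trace = ∑ i, l i ^ 2 := by
    rw [← hM, hs']
    rw [show U * diagonal l * Uᵀ * (U * diagonal l * Uᵀ) =
      U * diagonal l * (Uᵀ * U) * diagonal l * Uᵀ by simp only [mul_assoc], hU2, mul_one,
      trace_mul_comm, mul_assoc, ← mul_assoc Uᵀ, hU2, one_mul, diagonal_mul_diagonal,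
      trace_diagonal]
    simp [pow_two]
  have hrot := gv_rot k Uᵀ (by rw [transpose_transpose, hU2])
  have hd := gv_diag k l hε
  rw [← htr2, ← htr] at hd
  refine le_trans ((le_of_eq ?_).trans (hrot.measure_preimage_le _)) hd
  congr 1
  ext x
  simp only [Set.mem_ofPred_eq, Set.mem_preimage]
  have : x ⬝ᵥ (M *ᵥ x) = ∑ i, l i * (Uᵀ *ᵥ x) i ^ 2 := by
    conv_lhs => rw [hs']
    rw [← mulVec_mulVec, ← mulVec_mulVec, dotProduct_mulVec, ← mulVec_transpose]
    simp only [dotProduct, mulVec_diagonal]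
    refine Finset.sum_congr rfl fun i _ => by ring
  rw [this]

lemma gram_det_ne (n p : ℕ) (X : Matrix (Fin n) (Fin p) ℝ)
    (h : ∀ v, Xᵀ *ᵥ v = 0 → v = 0) : (X * Xᵀ).det ≠ 0 := by
  intro h0
  obtain ⟨v, hv, hv2⟩ := exists_mulVec_eq_zero_iff.2 h0
  refine hv (h v ?_)
  have : (Xᵀ *ᵥ v) ⬝ᵥ (Xᵀ *ᵥ v) = 0 := by
    rw [dotProduct_mulVec, vecMul_transpose, mulVec_mulVec, hv2, zero_dotProduct]
  exact dotProduct_self_eq_zero.1 this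

lemma meas_gram_det (n p : ℕ) :
    Measurable (fun X : Fin n → Fin p → ℝ => ((of X) * (of X)ᵀ).det) := by
  refine Continuous.measurable ?_
  refine Continuous.matrix_det ?_
  have : Continuous (fun X : Fin n → Fin p → ℝ => (of X : Matrix _ _ ℝ)) := continuous_id
  exact this.matrix_mul this.matrix_transpose

lemma gm_cons (m p : ℕ) : MeasurePreserving
    (fun z : (Fin p → ℝ) × (Fin m → Fin p → ℝ) => (Fin.cons z.1 z.2 : Fin (m+1) → Fin p → ℝ))
    ((stdGaussianVec p).prod (stdGaussianMatrix m p)) (stdGaussianMatrix (m + 1) p) := by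
  have h := (measurePreserving_piFinSuccAbove (fun _ : Fin (m+1) => stdGaussianVec p) 0).symm
  convert! h using 1
  ext z i j
  simp [MeasurableEquiv.piFinSuccAbove]

lemma gm_ae_of_cons (m p : ℕ) (P : (Fin (m+1) → Fin p → ℝ) → Prop)
    (hP : MeasurableSet {X | P X})
    (h : ∀ᵐ B ∂(stdGaussianMatrix m p), ∀ᵐ a ∂(stdGaussianVec p), P (Fin.cons a B)) :
    ∀ᵐ X ∂(stdGaussianMatrix (m+1) p), P X := by
  have hc := gm_cons m p
  rw [← hc.map_eq, ae_map_iff hc.measurable.aemeasurable hP]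
  refine (Measure.ae_prod_iff_ae_ae (p := fun z => P (Fin.cons z.1 z.2)) (hc.measurable hP)).2 ?_
  exact (Measure.ae_ae_comm (p := fun a B => P (Fin.cons a B)) (hc.measurable hP)).2 h

lemma gv_dot_ne (p : ℕ) (c : Fin p → ℝ) (hc : c ≠ 0) :
    ∀ᵐ a ∂(stdGaussianVec p), c ⬝ᵥ a ≠ 0 := by
  have h := gv_dot p c
  have hpos : 0 < c ⬝ᵥ c := by simpa using dotProduct_star_self_pos_iff.2 hc
  have hv : (c ⬝ᵥ c).toNNReal ≠ 0 := by simpa using hpos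
  have : ∀ᵐ y ∂(gaussianReal 0 (c ⬝ᵥ c).toNNReal), y ≠ 0 := by
    have := nullSingletonClass_gaussianReal (μ := 0) hv
    rw [ae_iff]; simp
  rw [← h.map_eq] at this
  exact ae_of_ae_map h.measurable.aemeasurable this

lemma gm_fullrank (n p : ℕ) (hnp : n ≤ p) :
    ∀ᵐ X ∂(stdGaussianMatrix n p), ((of X) * (of X)ᵀ).det ≠ 0 := by
  induction n with
  | zero => exact ae_of_all _ fun X => by simp
  | succ m ih =>
    refine gm_ae_of_cons m p (fun X => ((of X) * (of X)ᵀ).det ≠ 0)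
      ((meas_gram_det _ _) (measurableSet_singleton 0).compl) ?_
    filter_upwards [ih (by omega)] with B hB
    obtain ⟨c, hc, hc0⟩ : ∃ c : Fin p → ℝ, (of B) *ᵥ c = 0 ∧ c ≠ 0 := by
      have := LinearMap.ker_ne_bot_of_finrank_lt (f := (of B).mulVecLin) (by simp; omega)
      obtain ⟨c, hc, hc0⟩ := (Submodule.ne_bot_iff _).1 this
      exact ⟨c, by simpa using hc, hc0⟩
    filter_upwards [gv_dot_ne p c hc0] with a ha
    refine gram_det_ne _ _ _ fun v hv => ?_
    have hv' : v 0 • a + (of B)ᵀ *ᵥ (fun i => v i.succ) = 0 := by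
      rw [← hv]
      ext j
      simp [mulVec, dotProduct, Fin.sum_univ_succ, mul_comm]
    have h0 : v 0 = 0 := by
      have := congrArg (fun x => c ⬝ᵥ x) hv'
      simp only [dotProduct_add, dotProduct_smul, dotProduct_zero] at this
      rw [dotProduct_mulVec, vecMul_transpose, hc, zero_dotProduct, add_zero] at this
      simpa [ha] using this
    rw [h0, zero_smul, zero_add] at hv'
    have h1 : (fun i : Fin m => v i.succ) = 0 := by
      by_contra hne
      exact hB (exists_mulVec_eq_zero_iff.1 ⟨_, hne, by rw [← mulVec_mulVec, hv', mulVec_zero]⟩)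
    ext i
    refine Fin.cases h0 (fun i => congrFun h1 i) i

/-- Explicit right inverse. -/
noncomputable def RR {n p : ℕ} (X : Fin n → Fin p → ℝ) : Matrix (Fin p) (Fin n) ℝ :=
  (of X)ᵀ * ((of X) * (of X)ᵀ)⁻¹

/-- Projection on the row space. -/
noncomputable def PP {n p : ℕ} (X : Fin n → Fin p → ℝ) : Matrix (Fin p) (Fin p) ℝ :=
  RR X * of X

section
variable {n p : ℕ} (X : Fin n → Fin p → ℝ)

lemma mul_RR (h : ((of X) * (of X)ᵀ).det ≠ 0) : of X * RR X = 1 := by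
  rw [RR, ← Matrix.mul_assoc, mul_nonsing_inv _ (isUnit_iff_ne_zero.2 h)]

lemma gramInv_T : (((of X) * (of X)ᵀ)⁻¹)ᵀ = ((of X) * (of X)ᵀ)⁻¹ := by
  rw [transpose_nonsing_inv, transpose_mul, transpose_transpose]

lemma PP_T : (PP X)ᵀ = PP X := by
  rw [PP, RR, transpose_mul, transpose_mul, gramInv_T, transpose_transpose, Matrix.mul_assoc]

lemma PP_idem (h : ((of X) * (of X)ᵀ).det ≠ 0) : PP X * PP X = PP X := by
  rw [PP, Matrix.mul_assoc, ← Matrix.mul_assoc (of X), mul_RR X h, Matrix.one_mul]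

lemma PP_RR (h : ((of X) * (of X)ᵀ).det ≠ 0) : PP X * RR X = RR X := by
  rw [PP, Matrix.mul_assoc, mul_RR X h, Matrix.mul_one]

lemma PP_trace (h : ((of X) * (of X)ᵀ).det ≠ 0) : (PP X).trace = n := by
  rw [PP, trace_mul_comm, mul_RR X h]; simp

lemma QQ_idem (h : ((of X) * (of X)ᵀ).det ≠ 0) : (1 - PP X) * (1 - PP X) = 1 - PP X := by
  rw [Matrix.sub_mul, Matrix.mul_sub, Matrix.mul_sub, Matrix.one_mul, Matrix.mul_one,
    Matrix.one_mul, PP_idem X h]; simp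

lemma QQ_T : (1 - PP X)ᵀ = 1 - PP X := by
  rw [transpose_sub, transpose_one, PP_T]

lemma QQ_trace (h : ((of X) * (of X)ᵀ).det ≠ 0) : (1 - PP X).trace = p - n := by
  rw [trace_sub, trace_one, PP_trace X h]; simp

lemma pinv_unique {m n : ℕ} {A : Matrix (Fin m) (Fin n) ℝ} {B C : Matrix (Fin n) (Fin m) ℝ}
    (hB : A * B * A = A ∧ B * A * B = B ∧ (A * B)ᵀ = A * B ∧ (B * A)ᵀ = B * A)
    (hC : A * C * A = A ∧ C * A * C = C ∧ (A * C)ᵀ = A * C ∧ (C * A)ᵀ = C * A) : B = C := by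
  obtain ⟨b1, b2, b3, b4⟩ := hB
  obtain ⟨c1, c2, c3, c4⟩ := hC
  have h1 : A * B = A * C := by
    calc A * B = (A * C) * (A * B) := by rw [← Matrix.mul_assoc, c1]
      _ = ((A * B) * (A * C))ᵀ := by rw [transpose_mul, b3, c3]
      _ = A * C := by rw [← Matrix.mul_assoc, b1, c3]
  have h2 : B * A = C * A := by
    calc B * A = (B * A) * (C * A) := by rw [Matrix.mul_assoc, ← Matrix.mul_assoc A, c1]
      _ = ((C * A) * (B * A))ᵀ := by rw [transpose_mul, b4, c4]
      _ = C * A := by rw [Matrix.mul_assoc, ← Matrix.mul_assoc A, b1, c4]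
  calc B = B * A * B := b2.symm
    _ = C * A * C := by rw [Matrix.mul_assoc, h1, ← Matrix.mul_assoc, h2]
    _ = C := c2

lemma pinv_eq_RR (h : ((of X) * (of X)ᵀ).det ≠ 0) : pinv (of X) = RR X := by
  have hR : of X * RR X * of X = of X ∧ RR X * of X * RR X = RR X ∧
      (of X * RR X)ᵀ = of X * RR X ∧ (RR X * of X)ᵀ = RR X * of X := by
    refine ⟨?_, ?_, ?_, PP_T X⟩
    · rw [mul_RR X h, Matrix.one_mul]
    · exact PP_RR X h
    · rw [mul_RR X h, transpose_one]
  have hex : ∃ B : Matrix (Fin p) (Fin n) ℝ,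
      of X * B * of X = of X ∧ B * of X * B = B ∧ (of X * B)ᵀ = of X * B ∧
        (B * of X)ᵀ = B * of X := ⟨_, hR⟩
  unfold pinv
  rw [dif_pos hex]
  exact pinv_unique hex.choose_spec hR

lemma measurable_RR (i : Fin p) (j : Fin n) : Measurable (fun X : Fin n → Fin p → ℝ => RR X i j) := by
  have c1 : Continuous (fun X : Fin n → Fin p → ℝ => (of X : Matrix _ _ ℝ)) := continuous_id
  have c2 := c1.matrix_mul c1.matrix_transpose
  have c3 := c1.matrix_transpose.matrix_mul c2.matrix_adjugate
  have e : (fun X : Fin n → Fin p → ℝ => RR X i j) = fun X : Fin n → Fin p → ℝ =>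
      (((of X) * (of X)ᵀ).det)⁻¹ * ((of X)ᵀ * ((of X) * (of X)ᵀ).adjugate) i j := by
    ext X
    rw [RR, inv_def, Ring.inverse_eq_inv', Matrix.mul_smul, Matrix.smul_apply, smul_eq_mul]
  rw [e]
  exact (meas_gram_det n p).inv.mul (c3.matrix_elem i j).measurable

lemma RR_rot_right (O : Matrix (Fin p) (Fin p) ℝ) (hO : Oᵀ * O = 1) :
    RR (fun i => O *ᵥ X i) = O * RR X := by
  have e : (of (fun i => O *ᵥ X i) : Matrix (Fin n) (Fin p) ℝ) = of X * Oᵀ := by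
    ext i j
    simp [mul_apply, mulVec, dotProduct, mul_comm]
  rw [RR, RR, e, transpose_mul, transpose_transpose]
  rw [show of X * Oᵀ * (O * (of X)ᵀ) = of X * (Oᵀ * O) * (of X)ᵀ by simp only [Matrix.mul_assoc], hO,
    Matrix.mul_one, Matrix.mul_assoc]

lemma RR_rot_left (O : Matrix (Fin n) (Fin n) ℝ) (hO : O * Oᵀ = 1) (hO' : Oᵀ * O = 1) :
    RR (fun i j => ∑ k, O i k * X k j) = RR X * Oᵀ := by
  have e : (of (fun i j => ∑ k, O i k * X k j) : Matrix (Fin n) (Fin p) ℝ) = O * of X := by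
    ext i j
    simp [mul_apply]
  have i1 : O⁻¹ = Oᵀ := inv_eq_right_inv hO
  have i2 : (Oᵀ)⁻¹ = O := inv_eq_right_inv hO'
  rw [RR, RR, e, transpose_mul]
  rw [show O * of X * ((of X)ᵀ * Oᵀ) = O * ((of X * (of X)ᵀ) * Oᵀ) by simp only [Matrix.mul_assoc],
    Matrix.mul_inv_rev, Matrix.mul_inv_rev, i1, i2]
  rw [show (of X)ᵀ * Oᵀ * (O * (of X * (of X)ᵀ)⁻¹ * Oᵀ) =
    (of X)ᵀ * (Oᵀ * O) * (of X * (of X)ᵀ)⁻¹ * Oᵀ by simp only [Matrix.mul_assoc], hO', Matrix.mul_one]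

end

lemma RR_cons {m p : ℕ} (a : Fin p → ℝ) (B : Fin m → Fin p → ℝ)
    (hB : ((of B) * (of B)ᵀ).det ≠ 0)
    (hX : ((of (Fin.cons a B : Fin (m+1) → Fin p → ℝ)) *
      (of (Fin.cons a B : Fin (m+1) → Fin p → ℝ))ᵀ).det ≠ 0) :
    (a ⬝ᵥ ((1 - PP B) *ᵥ a)) *
      ((RR (Fin.cons a B : Fin (m+1) → Fin p → ℝ) *ᵥ Pi.single 0 1) ⬝ᵥ
        (RR (Fin.cons a B : Fin (m+1) → Fin p → ℝ) *ᵥ Pi.single 0 1)) = 1 := by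
  set X : Fin (m+1) → Fin p → ℝ := Fin.cons a B with hXdef
  set d := (1 - PP B) *ᵥ a with hd
  set u : Fin (m+1) → ℝ := Fin.cons 1 (-(((of B) * (of B)ᵀ)⁻¹ *ᵥ (of B *ᵥ a))) with hu
  have hdu : d = (of X)ᵀ *ᵥ u := by
    have : (of X)ᵀ *ᵥ u = a + (of B)ᵀ *ᵥ (-(((of B) * (of B)ᵀ)⁻¹ *ᵥ (of B *ᵥ a))) := by
      ext j
      simp [mulVec, dotProduct, Fin.sum_univ_succ, hXdef, hu]
    rw [this, hd, sub_mulVec, one_mulVec, PP, RR, mulVec_neg, mulVec_mulVec, mulVec_mulVec,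
      sub_eq_add_neg]
  have hBd : of B *ᵥ d = 0 := by
    rw [hd, mulVec_mulVec, PP, Matrix.mul_sub, Matrix.mul_one, ← Matrix.mul_assoc, mul_RR B hB, Matrix.one_mul, sub_self,
      zero_mulVec]
  have hidem := QQ_idem B hB
  have hT := QQ_T B
  have had : a ⬝ᵥ d = d ⬝ᵥ d := by
    conv_rhs => rw [hd, dotProduct_mulVec, ← mulVec_transpose, hT, mulVec_mulVec, hidem]
    rw [dotProduct_comm]
  have hXd : of X *ᵥ d = (d ⬝ᵥ d) • Pi.single 0 1 := by
    ext i
    refine Fin.cases ?_ (fun i => ?_) i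
    · simp [← had, hXdef, mulVec]
    · have := congrFun hBd i
      simpa [hXdef, mulVec] using this
  have hRd : RR X *ᵥ (of X *ᵥ d) = d := by
    rw [hdu, mulVec_mulVec, mulVec_mulVec, RR, Matrix.mul_assoc, Matrix.mul_assoc, nonsing_inv_mul _ (isUnit_iff_ne_zero.2 hX), Matrix.mul_one]
  have hd0 : d ⬝ᵥ d ≠ 0 := by
    intro h0
    have h1 : d = 0 := dotProduct_self_eq_zero.1 h0
    have hu0 : u ≠ 0 := fun h => by simpa [hu] using congrFun h 0
    exact hX (exists_mulVec_eq_zero_iff.1 ⟨u, hu0, by rw [← mulVec_mulVec, ← hdu, h1, mulVec_zero]⟩)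
  rw [hXd, mulVec_smul] at hRd
  set w := RR X *ᵥ Pi.single 0 1 with hw
  rw [had]
  have h2 : (d ⬝ᵥ d) * ((d ⬝ᵥ d) * (w ⬝ᵥ w)) = d ⬝ᵥ d := by
    conv_rhs => rw [← hRd]
    rw [smul_dotProduct, dotProduct_smul, smul_eq_mul, smul_eq_mul]
  exact mul_left_cancel₀ hd0 (by rw [h2, _root_.mul_one])

lemma mp_append (p r : ℕ) : MeasurePreserving
    (fun z : (Fin p → ℝ) × (Fin r → ℝ) => (Fin.append z.1 z.2 : Fin (p + r) → ℝ))
    ((stdGaussianVec p).prod (stdGaussianVec r)) (stdGaussianVec (p + r)) := by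
  have hm : Measurable
      (fun z : (Fin p → ℝ) × (Fin r → ℝ) => (Fin.append z.1 z.2 : Fin (p + r) → ℝ)) := by
    refine measurable_pi_iff.2 fun i => ?_
    refine Fin.addCases (fun i => ?_) (fun i => ?_) i
    · simp only [Fin.append_left]; fun_prop
    · simp only [Fin.append_right]; fun_prop
  refine ⟨hm, ?_⟩
  symm
  refine Measure.pi_eq fun s hs => ?_
  rw [Measure.map_apply hm (MeasurableSet.univ_pi hs)]
  have : (fun z : (Fin p → ℝ) × (Fin r → ℝ) => (Fin.append z.1 z.2 : Fin (p + r) → ℝ)) ⁻¹'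
      (Set.univ.pi s) = (Set.univ.pi fun i => s (Fin.castAdd r i)) ×ˢ
        (Set.univ.pi fun i => s (Fin.natAdd p i)) := by
    ext z
    simp only [Set.mem_preimage, Set.mem_univ_pi, Set.mem_prod]
    constructor
    · intro h
      exact ⟨fun i => by simpa using h (Fin.castAdd r i), fun i => by simpa using h (Fin.natAdd p i)⟩
    · intro h i
      refine Fin.addCases (fun i => ?_) (fun i => ?_) i
      · simpa using h.1 i
      · simpa using h.2 i
  rw [this, Measure.prod_prod, stdGaussianVec, stdGaussianVec, Measure.pi_pi, Measure.pi_pi,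
    Fin.prod_univ_add]

lemma mp_append_mat (n p r : ℕ) : MeasurePreserving
    (fun z : (Fin n → Fin p → ℝ) × (Fin n → Fin r → ℝ) =>
      (fun i => Fin.append (z.1 i) (z.2 i) : Fin n → Fin (p + r) → ℝ))
    ((stdGaussianMatrix n p).prod (stdGaussianMatrix n r)) (stdGaussianMatrix n (p + r)) := by
  have h1 := (measurePreserving_arrowProdEquivProdArrow (Fin p → ℝ) (Fin r → ℝ) (Fin n)
    (fun _ => stdGaussianVec p) (fun _ => stdGaussianVec r)).symm
  have h2 := measurePreserving_pi (fun _ : Fin n => (stdGaussianVec p).prod (stdGaussianVec r))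
    (fun _ : Fin n => stdGaussianVec (p + r)) (fun _ => mp_append p r)
  exact h2.comp h1

section swaps
variable {α β γ δ ε : Type*} [MeasurableSpace α] [MeasurableSpace β] [MeasurableSpace γ]
  [MeasurableSpace δ] [MeasurableSpace ε]
  (μa : Measure α) (μb : Measure β) (μc : Measure γ) (μd : Measure δ) (μe : Measure ε)
  [IsProbabilityMeasure μa] [IsProbabilityMeasure μb] [IsProbabilityMeasure μc]
  [IsProbabilityMeasure μd] [IsProbabilityMeasure μe]

lemma mp_swap12 : MeasurePreserving (fun z : α × (β × γ) => (z.2.1, (z.1, z.2.2)))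
    (μa.prod (μb.prod μc)) (μb.prod (μa.prod μc)) := by
  have h1 := (measurePreserving_prodAssoc μa μb μc).symm
  have h2 := (Measure.measurePreserving_swap (μ := μa) (ν := μb)).prod (MeasurePreserving.id μc)
  have h3 := (measurePreserving_prodAssoc μb μa μc)
  exact (h3.comp h2).comp h1

lemma mp_rearr : MeasurePreserving
    (fun z : α × (β × (γ × (δ × ε))) => ((z.1, z.2.2.1), ((z.2.1, z.2.2.2.1), z.2.2.2.2)))
    (μa.prod (μb.prod (μc.prod (μd.prod μe))))
    ((μa.prod μc).prod ((μb.prod μd).prod μe)) := by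
  have h1 := (MeasurePreserving.id μa).prod (mp_swap12 μb μc (μd.prod μe))
  have h2 := (measurePreserving_prodAssoc μa μc (μb.prod (μd.prod μe))).symm
  have h3 := (MeasurePreserving.id (μa.prod μc)).prod (measurePreserving_prodAssoc μb μd μe).symm
  exact (h3.comp h2).comp h1

end swaps

/-- the effective noise -/
noncomputable def vv (σ : ℝ) (D : ℕ) {n r : ℕ} (X : Fin n → Fin r → ℝ) (b : Fin r → ℝ)
    (e : Fin n → ℝ) : Fin n → ℝ := fun i => (X i ⬝ᵥ b) / Real.sqrt D + σ * e i

/-- the effective noise variance -/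
noncomputable def tau2 (σ : ℝ) (D : ℕ) {r : ℕ} (b : Fin r → ℝ) : ℝ := (b ⬝ᵥ b) / D + σ ^ 2

lemma tau2_nonneg (σ : ℝ) (D : ℕ) {r : ℕ} (b : Fin r → ℝ) : 0 ≤ tau2 σ D b := by
  have : 0 ≤ b ⬝ᵥ b := by simpa using dotProduct_star_self_nonneg b
  unfold tau2; positivity

lemma row_law (σ : ℝ) (r : ℕ) (c : Fin r → ℝ) : MeasurePreserving
    (fun z : (Fin r → ℝ) × ℝ => c ⬝ᵥ z.1 + σ * z.2)
    ((stdGaussianVec r).prod (gaussianReal 0 1)) (gaussianReal 0 (c ⬝ᵥ c + σ ^ 2).toNNReal) := by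
  have h1 : MeasurePreserving (fun x : ℝ => σ * x) (gaussianReal 0 1)
      (gaussianReal 0 (σ ^ 2).toNNReal) := by
    refine ⟨by fun_prop, ?_⟩
    rw [gaussianReal_map_const_mul]
    congr 1
    · simp
    · ext; simp [sq_nonneg]
  have h2 := (gv_dot r c).prod h1
  have h3 : MeasurePreserving (fun z : ℝ × ℝ => z.1 + z.2)
      ((gaussianReal 0 (c ⬝ᵥ c).toNNReal).prod (gaussianReal 0 (σ ^ 2).toNNReal))
      (gaussianReal 0 (c ⬝ᵥ c + σ ^ 2).toNNReal) := by
    refine ⟨by fun_prop, ?_⟩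
    have := gaussianReal_conv_gaussianReal (m₁ := 0) (m₂ := 0) (v₁ := (c ⬝ᵥ c).toNNReal)
      (v₂ := (σ ^ 2).toNNReal)
    rw [Measure.conv] at this
    rw [this, add_zero, Real.toNNReal_add (by simpa using dotProduct_star_self_nonneg c)
      (sq_nonneg _)]
  exact h3.comp h2

lemma vv_law_fixed (σ : ℝ) (D n r : ℕ) (b : Fin r → ℝ) :
    ((stdGaussianMatrix n r).prod (stdGaussianVec n)).map (fun z => vv σ D z.1 b z.2)
      = (stdGaussianVec n).map (fun g => Real.sqrt (tau2 σ D b) • g) := by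
  have ha := (measurePreserving_arrowProdEquivProdArrow (Fin r → ℝ) ℝ (Fin n)
    (fun _ => stdGaussianVec r) (fun _ => gaussianReal 0 1)).symm
  have hc : ((1 / Real.sqrt D) • b) ⬝ᵥ ((1 / Real.sqrt D) • b) + σ ^ 2 = tau2 σ D b := by
    simp only [smul_dotProduct, dotProduct_smul, smul_eq_mul, tau2]
    have : Real.sqrt D * Real.sqrt D = D := Real.mul_self_sqrt (by positivity)
    rw [← mul_assoc, div_mul_div_comm, this]; ring
  have hr := row_law σ r ((1 / Real.sqrt D) • b)
  rw [hc] at hr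
  have hp := (measurePreserving_pi (fun _ : Fin n => (stdGaussianVec r).prod (gaussianReal 0 1))
    (fun _ : Fin n => gaussianReal 0 (tau2 σ D b).toNNReal) (fun _ => hr)).comp ha
  have hq : MeasurePreserving (fun x : ℝ => Real.sqrt (tau2 σ D b) * x) (gaussianReal 0 1)
      (gaussianReal 0 (tau2 σ D b).toNNReal) := by
    refine ⟨by fun_prop, ?_⟩
    rw [gaussianReal_map_const_mul]
    congr 1
    · simp
    · ext; simp [tau2_nonneg]
  have hq2 := (measurePreserving_pi (fun _ : Fin n => (gaussianReal 0 1))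
    (fun _ : Fin n => gaussianReal 0 (tau2 σ D b).toNNReal) (fun _ => hq))
  have e1 := hp.map_eq
  have e2 := hq2.map_eq
  rw [← e2] at e1
  refine Eq.trans ?_ e1
  refine congrArg (fun f => Measure.map f ((stdGaussianMatrix n r).prod (stdGaussianVec n))) ?_
  funext z i
  simp only [vv, MeasurableEquiv.arrowProdEquivProdArrow, Equiv.arrowProdEquivProdArrow,
    Function.comp, smul_dotProduct, smul_eq_mul]
  rw [dotProduct_comm, div_eq_mul_one_div, mul_comm (b ⬝ᵥ _)]
  rfl

lemma measurable_vv (σ : ℝ) (D n r : ℕ) : Measurable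
    (fun z : (Fin n → Fin r → ℝ) × ((Fin r → ℝ) × (Fin n → ℝ)) => vv σ D z.1 z.2.1 z.2.2) := by
  unfold vv dotProduct
  fun_prop

lemma measurable_tau2 (σ : ℝ) (D r : ℕ) : Measurable (fun b : Fin r → ℝ => tau2 σ D b) := by
  unfold tau2 dotProduct
  fun_prop

lemma measurable_tg (σ : ℝ) (D n r : ℕ) : Measurable
    (fun z : (Fin r → ℝ) × (Fin n → ℝ) => Real.sqrt (tau2 σ D z.1) • z.2) := by
  have := measurable_tau2 σ D r
  fun_prop

lemma vv_law (σ : ℝ) (D n r : ℕ) :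
    ((stdGaussianMatrix n r).prod ((stdGaussianVec r).prod (stdGaussianVec n))).map
      (fun z => vv σ D z.1 z.2.1 z.2.2)
      = ((stdGaussianVec r).prod (stdGaussianVec n)).map
        (fun z => Real.sqrt (tau2 σ D z.1) • z.2) := by
  have hs := mp_swap12 (stdGaussianVec r) (stdGaussianMatrix n r) (stdGaussianVec n)
  have hm := measurable_vv σ D n r
  have ht := measurable_tg σ D n r
  rw [← hs.map_eq, Measure.map_map hm hs.measurable]
  ext A hA
  rw [Measure.map_apply (hm.comp hs.measurable) hA, Measure.map_apply ht hA,
    Measure.prod_apply ((hm.comp hs.measurable) hA), Measure.prod_apply (ht hA)]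
  refine lintegral_congr fun b => ?_
  have : (_ : Measure (Fin n → ℝ)) A = (_ : Measure (Fin n → ℝ)) A := congrArg (fun μ => μ A) (vv_law_fixed σ D n r b)
  rw [Measure.map_apply (by unfold vv dotProduct; fun_prop) hA,
    Measure.map_apply (by fun_prop) hA] at this
  exact this

/-- the estimator as a function of design, coefficients, effective noise -/
noncomputable def bh (D : ℕ) {n p : ℕ} (X : Fin n → Fin p → ℝ) (b : Fin p → ℝ)
    (v : Fin n → ℝ) : Fin p → ℝ :=
  RR X *ᵥ (fun i => (X i ⬝ᵥ b) / Real.sqrt D + v i)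

lemma measurable_bh (D n p : ℕ) : Measurable
    (fun z : (Fin n → Fin p → ℝ) × ((Fin p → ℝ) × (Fin n → ℝ)) => bh D z.1 z.2.1 z.2.2) := by
  have h : ∀ i j, Measurable
      (fun z : (Fin n → Fin p → ℝ) × ((Fin p → ℝ) × (Fin n → ℝ)) => RR z.1 i j) :=
    fun i j => (measurable_RR i j).comp measurable_fst
  refine measurable_pi_iff.2 fun j => ?_
  unfold bh mulVec dotProduct
  refine Finset.measurable_fun_sum _ fun i _ => ?_
  refine (h j i).mul ?_
  fun_prop

/-- the reduced sample space law -/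
noncomputable abbrev P4 (n p r : ℕ) :
    Measure ((Fin n → Fin p → ℝ) × ((Fin p → ℝ) × ((Fin r → ℝ) × (Fin n → ℝ)))) :=
  (stdGaussianMatrix n p).prod
    ((stdGaussianVec p).prod ((stdGaussianVec r).prod (stdGaussianVec n)))

/-- the estimator on the reduced sample space -/
noncomputable def BH (σ : ℝ) (D : ℕ) {n p r : ℕ}
    (z : (Fin n → Fin p → ℝ) × ((Fin p → ℝ) × ((Fin r → ℝ) × (Fin n → ℝ)))) : Fin p → ℝ :=
  bh D z.1 z.2.1 (Real.sqrt (tau2 σ D z.2.2.1) • z.2.2.2)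

lemma measurable_BH (σ : ℝ) (D n p r : ℕ) : Measurable (BH σ D (n := n) (p := p) (r := r)) := by
  have h3 : Measurable (fun z : (Fin n → Fin p → ℝ) × ((Fin p → ℝ) × ((Fin r → ℝ) × (Fin n → ℝ))) =>
      Real.sqrt (tau2 σ D z.2.2.1) • z.2.2.2) :=
    (measurable_tg σ D n r).comp (measurable_snd.comp measurable_snd)
  have h2 : Measurable (fun z : (Fin n → Fin p → ℝ) × ((Fin p → ℝ) × ((Fin r → ℝ) × (Fin n → ℝ))) =>
      z.2.1) := measurable_fst.comp measurable_snd
  have h1 : Measurable (fun z : (Fin n → Fin p → ℝ) × ((Fin p → ℝ) × ((Fin r → ℝ) × (Fin n → ℝ))) =>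
      z.1) := measurable_fst
  have h4 := h1.prodMk (h2.prodMk h3)
  have h5 := (measurable_bh D n p).comp h4
  exact h5

lemma measurable_dotp {p : ℕ} (x : Fin p → ℝ) : Measurable (fun b : Fin p → ℝ => x ⬝ᵥ b) := by
  unfold dotProduct; fun_prop

/-- prediction with RR in place of pinv -/
noncomputable def mnp (σ : ℝ) (n p r : ℕ) (x : Fin p → ℝ)
    (ω : (Fin n → Fin (p + r) → ℝ) × (Fin (p + r) → ℝ) × (Fin n → ℝ)) : ℝ :=
  x ⬝ᵥ (RR (fun i j => ω.1 i (Fin.castAdd r j)) *ᵥ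
      (fun i => (∑ jd, ω.1 i jd * coeffs (p + r) ω.2.1 jd) + σ * ω.2.2 i))

lemma measurable_mnp (σ : ℝ) (n p r : ℕ) (x : Fin p → ℝ) : Measurable (mnp σ n p r x) := by
  have h : ∀ i j, Measurable
      (fun z : (Fin n → Fin (p + r) → ℝ) × (Fin (p + r) → ℝ) × (Fin n → ℝ) =>
        RR (fun i j => z.1 i (Fin.castAdd r j)) i j) :=
    fun i j => (measurable_RR (n := n) (p := p) i j).comp (by fun_prop)
  unfold mnp mulVec dotProduct
  refine Finset.measurable_fun_sum _ fun i _ => ?_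
  refine measurable_const.mul ?_
  refine Finset.measurable_fun_sum _ fun k _ => ?_
  refine (h i k).mul ?_
  unfold coeffs
  fun_prop

lemma mnp_ae (σ : ℝ) (n p r : ℕ) (hnp : n ≤ p) (h : p ≤ p + r) (x₀ : Fin (p + r) → ℝ) :
    minNormPrediction σ n p (p + r) h x₀ =ᵐ[(stdGaussianMatrix n (p + r)).prod
      ((stdGaussianVec (p + r)).prod (stdGaussianVec n))]
      mnp σ n p r (fun j => x₀ (Fin.castLE h j)) := by
  have h1 : ∀ᵐ X ∂(stdGaussianMatrix n (p + r)),
      ((of fun i j => X i (Fin.castAdd r j)) *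
        (of fun i j => X i (Fin.castAdd r j) : Matrix (Fin n) (Fin p) ℝ)ᵀ).det ≠ 0 := by
    rw [← (mp_append_mat n p r).map_eq, ae_map_iff (mp_append_mat n p r).measurable.aemeasurable]
    · simp only [Fin.append_left]
      exact Measure.quasiMeasurePreserving_fst.ae (gm_fullrank n p hnp)
    · have : Measurable (fun X : Fin n → Fin (p + r) → ℝ => (fun i j => X i (Fin.castAdd r j) : Fin n → Fin p → ℝ)) := by fun_prop
      exact ((meas_gram_det n p).comp this) (measurableSet_singleton (0:ℝ)).compl
  have h2 := (Measure.quasiMeasurePreserving_fst (μ := stdGaussianMatrix n (p + r))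
    (ν := (stdGaussianVec (p + r)).prod (stdGaussianVec n))).ae h1
  filter_upwards [h2] with ω hω
  unfold minNormPrediction mnp
  have : pinv (firstCols n p (p + r) h ω.1) = RR (fun i j => ω.1 i (Fin.castAdd r j)) :=
    pinv_eq_RR _ hω
  rw [this]; rfl

lemma mnp_law (σ : ℝ) (n p r : ℕ) (x : Fin p → ℝ) :
    ((stdGaussianMatrix n (p + r)).prod
      ((stdGaussianVec (p + r)).prod (stdGaussianVec n))).map (mnp σ n p r x)
    = (P4 n p r).map (fun z => x ⬝ᵥ BH σ (p + r) z) := by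
  have hΦ := ((mp_append_mat n p r).prod ((mp_append p r).prod
    (MeasurePreserving.id (stdGaussianVec n)))).comp
    (mp_rearr (stdGaussianMatrix n p) (stdGaussianVec p) (stdGaussianMatrix n r)
      (stdGaussianVec r) (stdGaussianVec n))
  set ν := ((stdGaussianVec r).prod (stdGaussianVec n)).map
        (fun z => Real.sqrt (tau2 σ (p + r : ℕ) z.1) • z.2) with hν
  have : IsProbabilityMeasure ν := Measure.isProbabilityMeasure_map (measurable_tg σ _ n r).aemeasurable
  have ht : MeasurePreserving (fun z : (Fin r → ℝ) × (Fin n → ℝ) => Real.sqrt (tau2 σ (p + r : ℕ) z.1) • z.2)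
    ((stdGaussianVec r).prod (stdGaussianVec n)) ν := ⟨measurable_tg σ _ n r, rfl⟩
  have hv : MeasurePreserving (fun z : (Fin n → Fin r → ℝ) × ((Fin r → ℝ) × (Fin n → ℝ)) => vv σ (p + r) z.1 z.2.1 z.2.2)
    ((stdGaussianMatrix n r).prod ((stdGaussianVec r).prod (stdGaussianVec n))) ν :=
    ⟨measurable_vv σ _ n r, vv_law σ _ n r⟩
  have ht2 := (MeasurePreserving.id (stdGaussianMatrix n p)).prod
    ((MeasurePreserving.id (stdGaussianVec p)).prod ht)
  have hv2 := (MeasurePreserving.id (stdGaussianMatrix n p)).prod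
    ((MeasurePreserving.id (stdGaussianVec p)).prod hv)
  have hF : Measurable (fun z : (Fin n → Fin p → ℝ) × ((Fin p → ℝ) × (Fin n → ℝ)) =>
      x ⬝ᵥ bh (p + r) z.1 z.2.1 z.2.2) := (measurable_dotp x).comp (measurable_bh _ _ _)
  have hFt := congrArg (Measure.map (fun z : (Fin n → Fin p → ℝ) × ((Fin p → ℝ) × (Fin n → ℝ)) =>
      x ⬝ᵥ bh (p + r) z.1 z.2.1 z.2.2)) ht2.map_eq
  have hFv := congrArg (Measure.map (fun z : (Fin n → Fin p → ℝ) × ((Fin p → ℝ) × (Fin n → ℝ)) =>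
      x ⬝ᵥ bh (p + r) z.1 z.2.1 z.2.2)) hv2.map_eq
  have hFm := congrArg (Measure.map (mnp σ n p r x)) hΦ.map_eq
  rw [Measure.map_map hF ht2.measurable] at hFt
  rw [Measure.map_map hF hv2.measurable] at hFv
  rw [Measure.map_map (measurable_mnp _ _ _ _ _) hΦ.measurable] at hFm
  refine hFm.symm.trans (Eq.trans ?_ (hFv.trans hFt.symm))
  refine congrArg (fun f => Measure.map f _) ?_
  funext z
  simp only [Function.comp, mnp, bh, Prod.map, Fin.append_left, id]
  congr 3
  funext i
  simp only [vv, coeffs, Fin.sum_univ_add, Fin.append_left, Fin.append_right, dotProduct]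
  rw [Finset.sum_div, Finset.sum_div]
  simp only [mul_div_assoc]
  ring

lemma dot_rot {p : ℕ} (O : Matrix (Fin p) (Fin p) ℝ) (hO : Oᵀ * O = 1) (x y : Fin p → ℝ) :
    (O *ᵥ x) ⬝ᵥ (O *ᵥ y) = x ⬝ᵥ y := by
  rw [dotProduct_mulVec, vecMul_mulVec, ← dotProduct_mulVec, hO, one_mulVec]

lemma dot_nonneg {p : ℕ} (x : Fin p → ℝ) : 0 ≤ x ⬝ᵥ x := by
  simpa using dotProduct_star_self_nonneg x

lemma BH_rot (σ : ℝ) (D n p r : ℕ) (O : Matrix (Fin p) (Fin p) ℝ) (hO : Oᵀ * O = 1)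
    (z : (Fin n → Fin p → ℝ) × ((Fin p → ℝ) × ((Fin r → ℝ) × (Fin n → ℝ)))) :
    BH σ D (fun i => O *ᵥ z.1 i, (O *ᵥ z.2.1, z.2.2)) = O *ᵥ BH σ D z := by
  simp only [BH, bh, RR_rot_right _ O hO, dot_rot O hO, mulVec_mulVec]

lemma BH_dot_law (σ : ℝ) (D n p r : ℕ) (x y : Fin p → ℝ) (h : x ⬝ᵥ x = y ⬝ᵥ y) :
    (P4 n p r).map (fun z => x ⬝ᵥ BH σ D z) = (P4 n p r).map (fun z => y ⬝ᵥ BH σ D z) := by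
  obtain ⟨O, h1, h2, h3⟩ := exists_rot p x y h
  have hmp := (gm_rot_right n p O h1).prod ((gv_rot p O h1).prod
    (MeasurePreserving.id ((stdGaussianVec r).prod (stdGaussianVec n))))
  have hm : Measurable (fun z => y ⬝ᵥ BH σ D (n := n) (p := p) (r := r) z) :=
    (measurable_dotp y).comp (measurable_BH σ D n p r)
  have e := congrArg (Measure.map (fun z => y ⬝ᵥ BH σ D z)) hmp.map_eq
  rw [Measure.map_map hm hmp.measurable] at e
  refine Eq.trans ?_ e
  refine congrArg (fun f => Measure.map f _) ?_
  funext z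
  have := BH_rot σ D n p r O h2 z
  simp only [Function.comp, Prod.map, id]
  rw [this, ← h3, dot_rot O h2]

/-- first basis vector -/
noncomputable def e0 (p : ℕ) : Fin p → ℝ := fun i => if i.val = 0 then 1 else 0

lemma e0_dot (p : ℕ) (hp : 0 < p) : e0 p ⬝ᵥ e0 p = 1 := by
  obtain ⟨q, rfl⟩ : ∃ q, p = q + 1 := ⟨p - 1, by omega⟩
  simp [e0, dotProduct]

lemma measurable_dot2 {α : Type*} [MeasurableSpace α] {p : ℕ} {f g : α → Fin p → ℝ}
    (hf : Measurable f) (hg : Measurable g) : Measurable (fun a => f a ⬝ᵥ g a) := by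
  unfold dotProduct
  refine Finset.measurable_fun_sum _ fun i _ => ?_
  exact ((measurable_pi_apply i).comp hf).mul ((measurable_pi_apply i).comp hg)

lemma gv_ne_zero (p : ℕ) (hp : 0 < p) : ∀ᵐ h ∂(stdGaussianVec p), 0 < h ⬝ᵥ h := by
  have h1 : e0 p ≠ 0 := by
    intro h; have := e0_dot p hp; rw [h] at this; simp at this
  filter_upwards [gv_dot_ne p _ h1] with h hh
  have : h ≠ 0 := by rintro rfl; simp at hh
  simpa using dotProduct_star_self_pos_iff.2 this

lemma sphere_trick {Ω : Type*} [MeasurableSpace Ω] (μ : Measure Ω) [IsProbabilityMeasure μ]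
    (p : ℕ) (hp : 0 < p) (W : Ω → Fin p → ℝ) (hW : Measurable W)
    (hinv : ∀ x y : Fin p → ℝ, x ⬝ᵥ x = y ⬝ᵥ y →
      μ.map (fun ω => x ⬝ᵥ W ω) = μ.map (fun ω => y ⬝ᵥ W ω)) (x : Fin p → ℝ) :
    μ.map (fun ω => x ⬝ᵥ W ω) = (μ.prod (stdGaussianVec p)).map
      (fun z => (Real.sqrt (x ⬝ᵥ x) / Real.sqrt (z.2 ⬝ᵥ z.2)) *
        (Real.sqrt (W z.1 ⬝ᵥ W z.1) * (e0 p ⬝ᵥ z.2))) := by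
  have hm1 : ∀ y : Fin p → ℝ, Measurable (fun ω => y ⬝ᵥ W ω) := fun y =>
    (measurable_dotp y).comp hW
  have hW1 : Measurable (fun z : Ω × (Fin p → ℝ) => W z.1) := hW.comp measurable_fst
  have hd : Measurable (fun z : Ω × (Fin p → ℝ) => Real.sqrt (x ⬝ᵥ x) / Real.sqrt (z.2 ⬝ᵥ z.2)) :=
    measurable_const.div (measurable_dot2 measurable_snd measurable_snd).sqrt
  have hm2 : Measurable (fun z : Ω × (Fin p → ℝ) =>
      (Real.sqrt (x ⬝ᵥ x) / Real.sqrt (z.2 ⬝ᵥ z.2)) *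
        (Real.sqrt (W z.1 ⬝ᵥ W z.1) * (e0 p ⬝ᵥ z.2))) :=
    hd.mul ((measurable_dot2 hW1 hW1).sqrt.mul ((measurable_dotp _).comp measurable_snd))
  have hm3 : Measurable (fun z : Ω × (Fin p → ℝ) =>
      (Real.sqrt (x ⬝ᵥ x) / Real.sqrt (z.2 ⬝ᵥ z.2)) * (W z.1 ⬝ᵥ z.2)) :=
    hd.mul (measurable_dot2 hW1 measurable_snd)
  ext A hA
  have key1 : (μ.prod (stdGaussianVec p)).map (fun z =>
      (Real.sqrt (x ⬝ᵥ x) / Real.sqrt (z.2 ⬝ᵥ z.2)) *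
        (Real.sqrt (W z.1 ⬝ᵥ W z.1) * (e0 p ⬝ᵥ z.2))) A
      = (μ.prod (stdGaussianVec p)).map (fun z =>
      (Real.sqrt (x ⬝ᵥ x) / Real.sqrt (z.2 ⬝ᵥ z.2)) * (W z.1 ⬝ᵥ z.2)) A := by
    rw [Measure.map_apply hm2 hA, Measure.map_apply hm3 hA, Measure.prod_apply (hm2 hA),
      Measure.prod_apply (hm3 hA)]
    refine lintegral_congr fun ω => ?_
    obtain ⟨O, h1, h2, h3⟩ := exists_rot p (Real.sqrt (W ω ⬝ᵥ W ω) • e0 p) (W ω) (by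
      rw [smul_dotProduct, dotProduct_smul, e0_dot p hp, smul_eq_mul, smul_eq_mul, mul_one,
        Real.mul_self_sqrt (dot_nonneg _)])
    have hr := gv_rot p O h1
    rw [← hr.measure_preimage (((measurable_prodMk_left (x := ω)) (hm3 hA)).nullMeasurableSet)]
    refine congrArg _ ?_
    ext h
    simp only [Set.mem_preimage]
    have h4 : W ω ⬝ᵥ (O *ᵥ h) = Real.sqrt (W ω ⬝ᵥ W ω) * (e0 p ⬝ᵥ h) := by
      conv_lhs => rw [← h3]
      rw [dot_rot O h2, smul_dotProduct, smul_eq_mul]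
    rw [dot_rot O h2, h4]
  rw [key1, Measure.map_apply hm3 hA, Measure.prod_apply_symm (hm3 hA)]
  have : ∀ᵐ h ∂(stdGaussianVec p), μ ((fun ω => (ω, h)) ⁻¹' ((fun z : Ω × (Fin p → ℝ) =>
      (Real.sqrt (x ⬝ᵥ x) / Real.sqrt (z.2 ⬝ᵥ z.2)) * (W z.1 ⬝ᵥ z.2)) ⁻¹' A))
      = μ.map (fun ω => x ⬝ᵥ W ω) A := by
    filter_upwards [gv_ne_zero p hp] with h hh
    rw [hinv x ((Real.sqrt (x ⬝ᵥ x) / Real.sqrt (h ⬝ᵥ h)) • h) ?_,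
      Measure.map_apply (hm1 _) hA]
    · refine congrArg _ ?_
      ext ω
      simp only [Set.mem_preimage, smul_dotProduct, smul_eq_mul, dotProduct_comm (W ω)]
    · rw [smul_dotProduct, dotProduct_smul, smul_eq_mul, smul_eq_mul, ← mul_assoc,
        div_mul_div_comm, Real.mul_self_sqrt (dot_nonneg _), Real.mul_self_sqrt (dot_nonneg _)]
      field_simp
  rw [lintegral_congr_ae this]
  simp

/-- convergence in probability to (moving) constants, along varying spaces -/
def Pto {Ω : ℕ → Type*} [∀ n, MeasurableSpace (Ω n)] (μ : ∀ n, Measure (Ω n))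
    (Z : ∀ n, Ω n → ℝ) (c : ℕ → ℝ) : Prop :=
  ∀ ε > 0, Tendsto (fun n => μ n {ω | ε ≤ |Z n ω - c n|}) atTop (𝓝 0)

section
variable {Ω Ω' : ℕ → Type*} [∀ n, MeasurableSpace (Ω n)] [∀ n, MeasurableSpace (Ω' n)]
  {μ : ∀ n, Measure (Ω n)} {ν : ∀ n, Measure (Ω' n)}
  {Z W V : ∀ n, Ω n → ℝ} {c d v : ℕ → ℝ}

lemma Pto.comb2 (hZ : Pto μ Z c) (hW : Pto μ W d)
    (h : ∀ ε > 0, ∃ δ > 0, ∀ᶠ n in atTop, ∀ᵐ ω ∂(μ n),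
      |Z n ω - c n| < δ → |W n ω - d n| < δ → |V n ω - v n| < ε) : Pto μ V v := by
  intro ε hε
  obtain ⟨δ, hδ, h⟩ := h ε hε
  have ht := (hZ δ hδ).add (hW δ hδ)
  rw [add_zero] at ht
  refine tendsto_of_tendsto_of_tendsto_of_le_of_le' tendsto_const_nhds ht
    (Eventually.of_forall fun _ => zero_le) ?_
  filter_upwards [h] with n hn
  refine (measure_mono_ae ?_).trans (measure_union_le _ _)
  filter_upwards [hn] with ω hω
  intro h1
  by_contra h2
  have h1' : ε ≤ |V n ω - v n| := h1
  have h3 : ¬ (δ ≤ |Z n ω - c n| ∨ δ ≤ |W n ω - d n|) := h2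
  push Not at h3
  exact absurd (hω h3.1 h3.2) (not_lt.2 h1')

lemma Pto.comb1 (hZ : Pto μ Z c)
    (h : ∀ ε > 0, ∃ δ > 0, ∀ᶠ n in atTop, ∀ᵐ ω ∂(μ n),
      |Z n ω - c n| < δ → |V n ω - v n| < ε) : Pto μ V v := by
  refine hZ.comb2 hZ fun ε hε => ?_
  obtain ⟨δ, hδ, h⟩ := h ε hε
  exact ⟨δ, hδ, h.mono fun n hn => hn.mono fun ω hω h1 _ => hω h1⟩

lemma Pto.congr (hZ : Pto μ Z c) (h : ∀ᶠ n in atTop, V n =ᵐ[μ n] Z n) : Pto μ V c := by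
  refine hZ.comb1 fun ε hε => ⟨ε, hε, h.mono fun n hn => hn.mono fun ω hω h1 => ?_⟩
  rwa [hω]

lemma Pto.center (hZ : Pto μ Z c) (h : Tendsto (fun n => c n - d n) atTop (𝓝 0)) :
    Pto μ Z d := by
  refine hZ.comb1 fun ε hε => ⟨ε / 2, by positivity, ?_⟩
  have h2 := h.eventually (Metric.ball_mem_nhds 0 (half_pos hε))
  filter_upwards [h2] with n hn
  refine ae_of_all _ fun ω h1 => ?_
  have hn : dist (c n - d n) 0 < ε / 2 := hn
  rw [Real.dist_eq, sub_zero] at hn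
  calc |Z n ω - d n| = |(Z n ω - c n) + (c n - d n)| := by ring_nf
    _ ≤ _ := abs_add_le _ _
    _ < ε := by linarith

lemma Pto.add (hZ : Pto μ Z c) (hW : Pto μ W d) :
    Pto μ (fun n ω => Z n ω + W n ω) (fun n => c n + d n) := by
  refine hZ.comb2 hW fun ε hε => ⟨ε / 2, by positivity, ?_⟩
  refine Eventually.of_forall fun n => ae_of_all _ fun ω h1 h2 => ?_
  calc |Z n ω + W n ω - (c n + d n)| = |(Z n ω - c n) + (W n ω - d n)| := by ring_nf
    _ ≤ _ := abs_add_le _ _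
    _ < ε := by linarith

lemma Pto.const (μ : ∀ n, Measure (Ω n)) (c : ℕ → ℝ) : Pto μ (fun n _ => c n) c := by
  intro ε hε
  have : ∀ n, {ω : Ω n | ε ≤ |c n - c n|} = ∅ := by
    intro n; ext ω; simp [hε]
  simp only [this, measure_empty]
  exact tendsto_const_nhds

lemma Pto.mul (hZ : Pto μ Z c) (hW : Pto μ W d) {K : ℝ} (hc : ∀ᶠ n in atTop, |c n| ≤ K)
    (hd : ∀ᶠ n in atTop, |d n| ≤ K) :
    Pto μ (fun n ω => Z n ω * W n ω) (fun n => c n * d n) := by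
  refine hZ.comb2 hW fun ε hε => ?_
  have hK : 0 ≤ K := by
    obtain ⟨n, hn⟩ := hc.exists
    exact (abs_nonneg _).trans hn
  refine ⟨min 1 (ε / (2 * K + 1)), by positivity, ?_⟩
  filter_upwards [hc, hd] with n hc hd
  refine ae_of_all _ fun ω h1 h2 => ?_
  have h1a := h1.trans_le (min_le_left _ _)
  have h1b := h1.trans_le (min_le_right _ _)
  have h2b := h2.trans_le (min_le_right _ _)
  rw [lt_div_iff₀ (by positivity)] at h1b h2b
  calc |Z n ω * W n ω - c n * d n| = |(Z n ω - c n) * (W n ω - d n) + (Z n ω - c n) * d n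
        + c n * (W n ω - d n)| := by ring_nf
    _ ≤ |(Z n ω - c n) * (W n ω - d n)| + |(Z n ω - c n) * d n| + |c n * (W n ω - d n)| :=
        abs_add_three _ _ _
    _ ≤ 1 * |W n ω - d n| + |Z n ω - c n| * K + K * |W n ω - d n| := by
        rw [abs_mul, abs_mul, abs_mul]; gcongr
    _ < ε := by
        by_cases hK0 : K = 0
        · subst hK0; linarith
        · have : 0 < K := lt_of_le_of_ne hK (Ne.symm hK0)
          set a := |Z n ω - c n|
          set b := |W n ω - d n|
          have e1 : (1 + K) * b * (2 * K + 1) < (1 + K) * ε := by nlinarith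
          have e2 : K * a * (2 * K + 1) < K * ε := by nlinarith
          have e3 : (1 * b + a * K + K * b) * (2 * K + 1) < ε * (2 * K + 1) := by nlinarith
          exact lt_of_mul_lt_mul_right e3 (by positivity)

lemma Pto.inv (hZ : Pto μ Z c) {κ : ℝ} (hκ : 0 < κ) (hc : ∀ᶠ n in atTop, κ ≤ c n) :
    Pto μ (fun n ω => (Z n ω)⁻¹) (fun n => (c n)⁻¹) := by
  refine hZ.comb1 fun ε hε => ?_
  refine ⟨min (κ / 2) (ε * κ ^ 2 / 2), by positivity, ?_⟩
  filter_upwards [hc] with n hc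
  refine ae_of_all _ fun ω h1 => ?_
  have h1a := h1.trans_le (min_le_left _ _)
  have h1b := h1.trans_le (min_le_right _ _)
  have hZ : κ / 2 < Z n ω := by have := (abs_lt.1 h1a).1; linarith
  have hZ0 : 0 < Z n ω := by linarith
  have hc0 : 0 < c n := by linarith
  have e : (Z n ω)⁻¹ - (c n)⁻¹ = -(Z n ω - c n) / (Z n ω * c n) := by field_simp; ring
  rw [e, abs_div, abs_neg, abs_of_pos (by positivity : 0 < Z n ω * c n),
    div_lt_iff₀ (by positivity)]
  refine h1b.trans ?_
  have : κ / 2 * κ < Z n ω * c n := by nlinarith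
  nlinarith

lemma Pto.pull {U : ∀ n, Ω' n → Ω n} (hZ : Pto μ Z c)
    (hU : ∀ n, MeasurePreserving (U n) (ν n) (μ n)) : Pto ν (fun n ω => Z n (U n ω)) c := by
  intro ε hε
  refine tendsto_of_tendsto_of_tendsto_of_le_of_le tendsto_const_nhds (hZ ε hε)
    (fun _ => zero_le) (fun n => ?_)
  exact (hU n).measure_preimage_le {ω | ε ≤ |Z n ω - c n|}

lemma Pto.of_bound (h : ∀ ε > 0, ∃ B : ℕ → ℝ, Tendsto B atTop (𝓝 0) ∧
    ∀ᶠ n in atTop, μ n {ω | ε ≤ |Z n ω - c n|} ≤ ENNReal.ofReal (B n)) : Pto μ Z c := by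
  intro ε hε
  obtain ⟨B, hB, h⟩ := h ε hε
  have := ENNReal.tendsto_ofReal hB
  rw [ENNReal.ofReal_zero] at this
  exact tendsto_of_tendsto_of_tendsto_of_le_of_le' tendsto_const_nhds this
    (Eventually.of_forall fun _ => zero_le) h

end

lemma sect_le {α β : Type*} [MeasurableSpace α] [MeasurableSpace β] (μ : Measure α)
    (ν : Measure β) [IsProbabilityMeasure μ] [IsProbabilityMeasure ν] {S : Set (α × β)}
    (hS : MeasurableSet S) {C : ℝ≥0∞} (h : ∀ᵐ y ∂ν, μ {x | (x, y) ∈ S} ≤ C) :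
    (μ.prod ν) S ≤ C := by
  rw [Measure.prod_apply_symm hS]
  calc _ ≤ ∫⁻ _, C ∂ν := lintegral_mono_ae h
    _ = C := by simp

lemma measurable_RRv {n p : ℕ} {α : Type*} [MeasurableSpace α] {f : α → Fin n → Fin p → ℝ}
    {v : α → Fin n → ℝ} (hf : Measurable f) (hv : Measurable v) :
    Measurable (fun a => RR (f a) *ᵥ v a) := by
  refine measurable_pi_iff.2 fun j => ?_
  unfold mulVec dotProduct
  refine Finset.measurable_fun_sum _ fun i _ => ?_
  exact ((measurable_RR j i).comp hf).mul ((measurable_pi_apply i).comp hv)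

lemma PP_mulVec {n p : ℕ} (X : Fin n → Fin p → ℝ) (v : Fin p → ℝ) :
    PP X *ᵥ v = RR X *ᵥ (fun i => X i ⬝ᵥ v) := by
  rw [PP, ← mulVec_mulVec]; rfl

lemma measurable_PPv {n p : ℕ} {α : Type*} [MeasurableSpace α] {f : α → Fin n → Fin p → ℝ}
    {v : α → Fin p → ℝ} (hf : Measurable f) (hv : Measurable v) :
    Measurable (fun a => PP (f a) *ᵥ v a) := by
  simp only [PP_mulVec]
  refine measurable_RRv hf ?_
  refine measurable_pi_iff.2 fun i => ?_
  exact measurable_dot2 ((measurable_pi_apply i).comp hf) hv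

lemma meas_dev {α : Type*} [MeasurableSpace α] {f : α → ℝ} (hf : Measurable f) (ε c : ℝ) :
    MeasurableSet {a | ε ≤ |f a - c|} :=
  measurableSet_le measurable_const (by fun_prop)

/-- squared norm of the first column of the pseudo-inverse -/
noncomputable def qq {n p : ℕ} (X : Fin n → Fin p → ℝ) : ℝ :=
  (RR X *ᵥ e0 n) ⬝ᵥ (RR X *ᵥ e0 n)

lemma measurable_qq {n p : ℕ} : Measurable (fun X : Fin n → Fin p → ℝ => qq X) := by
  have h := measurable_RRv (n := n) (p := p) (f := fun X => X) (v := fun _ => e0 n)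
    measurable_id measurable_const
  exact measurable_dot2 h h

lemma qq_bound (n p : ℕ) (hn : 0 < n) (hnp : n ≤ p) {ε : ℝ} (hε : 0 < ε) :
    stdGaussianMatrix n p {X | ε ≤ |(qq X)⁻¹ - (p - n + 1)|} ≤
      ENNReal.ofReal (vC * (p - n + 1) / ε ^ 2) := by
  obtain ⟨m, rfl⟩ : ∃ m, n = m + 1 := ⟨n - 1, by omega⟩
  have hc := gm_cons m p
  have hS : MeasurableSet {X : Fin (m + 1) → Fin p → ℝ |
      ε ≤ |(qq X)⁻¹ - ((p : ℝ) - (m + 1 : ℕ) + 1)|} :=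
    meas_dev (measurable_qq (n := m + 1) (p := p)).inv ε ((p : ℝ) - (m + 1 : ℕ) + 1)
  have hfull := gm_fullrank (m + 1) p hnp
  have hB := (Measure.quasiMeasurePreserving_snd (μ := stdGaussianVec p)
    (ν := stdGaussianMatrix m p)).ae (gm_fullrank m p (by omega))
  have hX := hc.quasiMeasurePreserving.ae hfull
  have hm : Measurable (fun z : (Fin p → ℝ) × (Fin m → Fin p → ℝ) =>
      z.1 ⬝ᵥ ((1 - PP z.2) *ᵥ z.1)) := by
    simp only [sub_mulVec, one_mulVec]
    exact measurable_dot2 measurable_fst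
      (measurable_fst.sub (measurable_PPv measurable_snd measurable_fst))
  have hS2 := meas_dev hm ε ((p : ℝ) - (m + 1 : ℕ) + 1)
  rw [← hc.measure_preimage hS.nullMeasurableSet]
  refine (measure_mono_ae (t := {z : (Fin p → ℝ) × (Fin m → Fin p → ℝ) |
    ε ≤ |z.1 ⬝ᵥ ((1 - PP z.2) *ᵥ z.1) - ((p : ℝ) - (m + 1 : ℕ) + 1)|}) ?_).trans ?_
  · filter_upwards [hB, hX] with z h1 h2 h3
    have h3' : ε ≤ |(qq (Fin.cons z.1 z.2 : Fin (m + 1) → Fin p → ℝ))⁻¹ -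
      ((p : ℝ) - (m + 1 : ℕ) + 1)| := h3
    have h4 := RR_cons z.1 z.2 h1 h2
    have h5 : (Pi.single 0 1 : Fin (m + 1) → ℝ) = e0 (m + 1) := by
      funext i
      by_cases hi : i = 0
      · subst hi; simp [e0]
      · have hi2 : i.val ≠ 0 := fun h => hi (Fin.ext h)
        rw [Pi.single_eq_of_ne hi]; simp only [e0, if_neg hi2]
    rw [h5] at h4
    have h6 : (qq (Fin.cons z.1 z.2 : Fin (m + 1) → Fin p → ℝ))⁻¹ =
        z.1 ⬝ᵥ ((1 - PP z.2) *ᵥ z.1) := by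
      rw [inv_eq_iff_eq_inv]; exact eq_inv_of_mul_eq_one_right h4
    rw [h6] at h3'
    exact h3'
  · refine sect_le _ _ hS2 ?_
    filter_upwards [gm_fullrank m p (by omega)] with B hB
    have := gv_quad p (1 - PP B) (QQ_T B) (QQ_idem B hB) hε
    rw [QQ_trace B hB] at this
    have e : (p : ℝ) - (m + 1 : ℕ) + 1 = p - m := by push_cast; ring
    rw [e]
    exact this

lemma norm_bound (k : ℕ) {ε : ℝ} (hε : 0 < ε) :
    stdGaussianVec k {x | ε ≤ |x ⬝ᵥ x - k|} ≤ ENNReal.ofReal (vC * k / ε ^ 2) := by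
  have := gv_quad k 1 transpose_one (Matrix.one_mul 1) hε
  simpa using this

lemma PP_bound (n p : ℕ) (hnp : n ≤ p) {ε : ℝ} (hε : 0 < ε) :
    ((stdGaussianVec p).prod (stdGaussianMatrix n p)) {z | ε ≤ |z.1 ⬝ᵥ (PP z.2 *ᵥ z.1) - n|} ≤
      ENNReal.ofReal (vC * n / ε ^ 2) := by
  have hm : Measurable (fun z : (Fin p → ℝ) × (Fin n → Fin p → ℝ) =>
      z.1 ⬝ᵥ (PP z.2 *ᵥ z.1)) :=
    measurable_dot2 measurable_fst (measurable_PPv measurable_snd measurable_fst)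
  refine sect_le _ _ (meas_dev hm ε n) ?_
  filter_upwards [gm_fullrank n p hnp] with X hX
  have := gv_quad p (PP X) (PP_T X) (PP_idem X hX) hε
  rw [PP_trace X hX] at this
  exact this

lemma dot_cheb (p : ℕ) (w : Fin p → ℝ) {ε : ℝ} (hε : 0 < ε) :
    stdGaussianVec p {b | ε ≤ |b ⬝ᵥ w|} ≤ ENNReal.ofReal ((w ⬝ᵥ w) / ε ^ 2) := by
  have h := gv_dot p w
  have h1 := h.measure_preimage_le {t : ℝ | ε ≤ |t|}
  have h2 := meas_ge_le_variance_div_sq (μ := gaussianReal 0 (w ⬝ᵥ w).toNNReal) (X := id)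
    (memLp_id_gaussianReal' 2 (by simp)) hε
  rw [variance_id_gaussianReal] at h2
  simp only [id, integral_id_gaussianReal, sub_zero, Real.coe_toNNReal _ (dot_nonneg w)] at h2
  refine le_trans (le_of_eq ?_) (h1.trans h2)
  refine congrArg _ ?_
  ext b
  simp only [Set.mem_preimage, Set.mem_ofPred_eq, dotProduct_comm]

/-- law of the noise term -/
lemma noise_law {β : Type*} [MeasurableSpace β] (ν : Measure β) [IsProbabilityMeasure ν]
    (n p : ℕ) (hn : 0 < n) (v : β → Fin n → ℝ) (hv : Measurable v) (ε c : ℝ) :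
    ((stdGaussianMatrix n p).prod ν) {z | ε ≤ |(RR z.1 *ᵥ v z.2) ⬝ᵥ (RR z.1 *ᵥ v z.2) - c|} =
    ((stdGaussianMatrix n p).prod ν) {z | ε ≤ |(v z.2 ⬝ᵥ v z.2) * qq z.1 - c|} := by
  have h1 : Measurable (fun z : (Fin n → Fin p → ℝ) × β => RR z.1 *ᵥ v z.2) :=
    measurable_RRv measurable_fst (hv.comp measurable_snd)
  have m1 := meas_dev (measurable_dot2 h1 h1) ε c
  have h2 : Measurable (fun z : (Fin n → Fin p → ℝ) × β => v z.2) := hv.comp measurable_snd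
  have h3 : Measurable (fun z : (Fin n → Fin p → ℝ) × β => (v z.2 ⬝ᵥ v z.2) * qq z.1) :=
    (measurable_dot2 h2 h2).mul (measurable_qq.comp measurable_fst)
  have m2 := meas_dev h3 ε c
  rw [Measure.prod_apply_symm m1, Measure.prod_apply_symm m2]
  refine lintegral_congr fun y => ?_
  obtain ⟨O, o1, o2, o3⟩ := exists_rot n (v y) (Real.sqrt (v y ⬝ᵥ v y) • e0 n) (by
      rw [smul_dotProduct, dotProduct_smul, e0_dot n hn, smul_eq_mul, smul_eq_mul, mul_one,
        Real.mul_self_sqrt (dot_nonneg _)])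
  have hr := gm_rot_left n p Oᵀ (by rw [transpose_transpose]; exact o2)
  have m1' : MeasurableSet ((fun x => (x, y)) ⁻¹'
      {z : (Fin n → Fin p → ℝ) × β | ε ≤ |(RR z.1 *ᵥ v z.2) ⬝ᵥ (RR z.1 *ᵥ v z.2) - c|}) :=
    measurable_prodMk_right m1
  rw [← hr.measure_preimage m1'.nullMeasurableSet]
  refine congrArg _ ?_
  ext X
  simp only [Set.mem_preimage, Set.mem_ofPred_eq]
  rw [RR_rot_left X Oᵀ (by rw [transpose_transpose]; exact o2)
    (by rw [transpose_transpose]; exact o1), transpose_transpose, ← mulVec_mulVec, o3,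
    mulVec_smul, smul_dotProduct, dotProduct_smul, smul_eq_mul, smul_eq_mul, ← mul_assoc,
    Real.mul_self_sqrt (dot_nonneg _)]
  rfl

lemma Pto.scale {Ω : ℕ → Type*} [∀ n, MeasurableSpace (Ω n)] {μ : ∀ n, Measure (Ω n)}
    {Z : ∀ n, Ω n → ℝ} {k N : ℕ → ℝ} (C : ℝ)
    (h : ∀ᶠ n in atTop, ∀ ε > 0, μ n {ω | ε ≤ |Z n ω - k n|} ≤ ENNReal.ofReal (C * k n / ε ^ 2))
    (hN : ∀ᶠ n in atTop, 0 < N n) (hk : Tendsto (fun n => k n / N n ^ 2) atTop (𝓝 0)) :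
    Pto μ (fun n ω => Z n ω / N n) (fun n => k n / N n) := by
  refine Pto.of_bound fun ε hε => ⟨fun n => C / ε ^ 2 * (k n / N n ^ 2), ?_, ?_⟩
  · simpa using hk.const_mul (C / ε ^ 2)
  · filter_upwards [h, hN] with n h hN
    have := h (ε * N n) (by positivity)
    have e1 : C * k n / (ε * N n) ^ 2 = C / ε ^ 2 * (k n / N n ^ 2) := by field_simp
    rw [e1] at this
    refine le_trans (measure_mono fun ω hω => ?_) this
    have hω' : ε ≤ |Z n ω / N n - k n / N n| := hω
    rw [← sub_div, abs_div, abs_of_pos hN, le_div_iff₀ hN] at hω'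
    exact hω'

lemma tendsto_kN {k N : ℕ → ℝ} (hk : ∀ n, 0 ≤ k n) (hkN : ∀ n, k n ≤ N n)
    (hN : ∀ n : ℕ, (n : ℝ) ≤ N n) : Tendsto (fun n => k n / N n ^ 2) atTop (𝓝 0) := by
  refine tendsto_of_tendsto_of_tendsto_of_le_of_le' tendsto_const_nhds
    tendsto_one_div_atTop_nhds_zero_nat (Eventually.of_forall fun n => ?_) ?_
  · have := hk n; positivity
  · filter_upwards [eventually_gt_atTop 0] with n hn
    have hn' : (0 : ℝ) < n := by exact_mod_cast hn
    have h1 := hN n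
    have h2 : 0 < N n := by linarith
    rw [div_le_div_iff₀ (by positivity) hn']
    have := hkN n
    have := hk n
    nlinarith

section
variable (γ : ℝ) (hγ : 1 < γ) (p : ℕ → ℕ) (hnp : ∀ n, n + 1 < p n)
  (hγlim : Tendsto (fun n => (p n : ℝ) / n) atTop (𝓝 γ))
include hγ hnp hγlim

lemma lim_ratio : Tendsto (fun n : ℕ => ((p n : ℝ) - n + 1) / n) atTop (𝓝 (γ - 1)) := by
  have h := (hγlim.sub_const 1).add (tendsto_one_div_atTop_nhds_zero_nat (𝕜 := ℝ))
  rw [add_zero] at h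
  refine h.congr' ?_
  filter_upwards [eventually_gt_atTop 0] with n hn
  have hn' : (0 : ℝ) < n := by exact_mod_cast hn
  field_simp

lemma lim_ratio2 : Tendsto (fun n : ℕ => (n : ℝ) / ((p n : ℝ) - n - 1)) atTop
    (𝓝 (γ - 1)⁻¹) := by
  have h := (hγlim.sub_const 1).sub (tendsto_one_div_atTop_nhds_zero_nat (𝕜 := ℝ))
  rw [sub_zero] at h
  refine (h.inv₀ (by linarith)).congr' ?_
  filter_upwards [eventually_gt_atTop 0] with n hn
  have hn' : (0 : ℝ) < n := by exact_mod_cast hn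
  have h2 : (n : ℝ) + 1 < p n := by exact_mod_cast hnp n
  rw [← inv_div]
  congr 1
  field_simp

lemma qq_lim : Pto (fun n => stdGaussianMatrix n (p n)) (fun n X => n * qq X)
    (fun _ => (γ - 1)⁻¹) := by
  have h1 := Pto.scale (μ := fun n => stdGaussianMatrix n (p n)) (Z := fun n X => (qq X)⁻¹)
    (k := fun n => (p n : ℝ) - n + 1) (N := fun n => (n : ℝ)) vC
    (by filter_upwards [eventually_gt_atTop 0] with n hn ε hε
        exact qq_bound n (p n) hn (by have := hnp n; omega) hε)
    (by filter_upwards [eventually_gt_atTop 0] with n hn; exact_mod_cast hn)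
    (by have := (lim_ratio γ hγ p hnp hγlim).mul (tendsto_one_div_atTop_nhds_zero_nat (𝕜 := ℝ))
        rw [mul_zero] at this
        refine this.congr fun n => ?_
        rw [div_mul_div_comm, mul_one, pow_two])
  have h2 := h1.center (d := fun _ => γ - 1) (by
    have := (lim_ratio γ hγ p hnp hγlim).sub_const (γ - 1)
    simpa using this)
  have h3 := h2.inv (κ := γ - 1) (by linarith) (Eventually.of_forall fun _ => le_rfl)
  simpa [mul_comm, div_eq_mul_inv] using h3

end

lemma Pto.norm (k : ℕ → ℕ) (N : ℕ → ℝ) (hkN : ∀ n, (k n : ℝ) ≤ N n) (hN : ∀ n : ℕ, (n : ℝ) ≤ N n) :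
    Pto (fun n => stdGaussianVec (k n)) (fun n x => (x ⬝ᵥ x) / N n) (fun n => k n / N n) :=
  Pto.scale vC (Eventually.of_forall fun n ε hε => norm_bound (k n) hε)
    (by filter_upwards [eventually_gt_atTop 0] with n hn
        have : (0 : ℝ) < n := by exact_mod_cast hn
        exact this.trans_le (hN n))
    (tendsto_kN (fun n => by positivity) hkN hN)

section main
variable (σ : ℝ) (hσ : 0 < σ) (γ : ℝ) (hγ : 1 < γ) (p r : ℕ → ℕ) (hnp : ∀ n, n + 1 < p n)
  (hγlim : Tendsto (fun n => (p n : ℝ) / n) atTop (𝓝 γ))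

lemma mp4_X (n p r : ℕ) : MeasurePreserving Prod.fst (P4 n p r) (stdGaussianMatrix n p) :=
  measurePreserving_fst
lemma mp4_b (n p r : ℕ) : MeasurePreserving (fun z => z.2.1) (P4 n p r) (stdGaussianVec p) :=
  measurePreserving_fst.comp measurePreserving_snd
lemma mp4_br (n p r : ℕ) : MeasurePreserving (fun z => z.2.2.1) (P4 n p r) (stdGaussianVec r) :=
  measurePreserving_fst.comp (measurePreserving_snd.comp measurePreserving_snd)
lemma mp4_g (n p r : ℕ) : MeasurePreserving (fun z => z.2.2.2) (P4 n p r) (stdGaussianVec n) :=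
  measurePreserving_snd.comp (measurePreserving_snd.comp measurePreserving_snd)
lemma mp4_bX (n p r : ℕ) : MeasurePreserving (fun z => (z.2.1, z.1)) (P4 n p r)
    ((stdGaussianVec p).prod (stdGaussianMatrix n p)) := by
  have h := ((MeasurePreserving.id (stdGaussianVec p)).prod
    (measurePreserving_fst (μ := stdGaussianMatrix n p)
      (ν := (stdGaussianVec r).prod (stdGaussianVec n)))).comp
    (mp_swap12 (stdGaussianMatrix n p) (stdGaussianVec p)
      ((stdGaussianVec r).prod (stdGaussianVec n)))
  exact h

/-- effective noise on the reduced space -/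
noncomputable def ev (σ : ℝ) (D : ℕ) {n r : ℕ} (z : (Fin r → ℝ) × (Fin n → ℝ)) : Fin n → ℝ :=
  Real.sqrt (tau2 σ D z.1) • z.2

lemma ev_dot (σ : ℝ) (D : ℕ) {n r : ℕ} (z : (Fin r → ℝ) × (Fin n → ℝ)) :
    ev σ D z ⬝ᵥ ev σ D z = tau2 σ D z.1 * (z.2 ⬝ᵥ z.2) := by
  rw [ev, smul_dotProduct, dotProduct_smul, smul_eq_mul, smul_eq_mul, ← mul_assoc,
    Real.mul_self_sqrt (tau2_nonneg _ _ _)]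

lemma measurable_ev (σ : ℝ) (D n r : ℕ) : Measurable (fun z : (Fin r → ℝ) × (Fin n → ℝ) => ev σ D z) := by
  have h := measurable_tg σ D n r
  unfold ev
  exact h

include hnp in
lemma rp_le (n : ℕ) : (n : ℝ) ≤ ((p n + r n : ℕ) : ℝ) := by
  have := hnp n
  exact_mod_cast (by omega : n ≤ p n + r n)

include hnp in
lemma A1_lim : Pto (fun n => P4 n (p n) (r n))
    (fun n z => (z.2.1 ⬝ᵥ (PP z.1 *ᵥ z.2.1)) / ((p n + r n : ℕ) : ℝ))
    (fun n => n / ((p n + r n : ℕ) : ℝ)) := by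
  have h := Pto.scale (μ := fun n => ((stdGaussianVec (p n)).prod (stdGaussianMatrix n (p n))))
    (Z := fun n z => z.1 ⬝ᵥ (PP z.2 *ᵥ z.1)) (k := fun n => (n : ℝ))
    (N := fun n => ((p n + r n : ℕ) : ℝ)) vC
    (Eventually.of_forall fun n ε hε => PP_bound n (p n) (by have := hnp n; omega) hε)
    (Eventually.of_forall fun n => by
      have := hnp n
      exact_mod_cast (by omega : 0 < p n + r n))
    (tendsto_kN (fun n => by positivity) (rp_le p r hnp) (rp_le p r hnp))
  have h2 := h.pull (fun n => mp4_bX n (p n) (r n))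
  exact h2

include hσ hγ hnp hγlim in
lemma A3_lim : Pto (fun n => P4 n (p n) (r n))
    (fun n z => (RR z.1 *ᵥ ev σ (p n + r n) z.2.2) ⬝ᵥ (RR z.1 *ᵥ ev σ (p n + r n) z.2.2))
    (fun n => (r n / ((p n + r n : ℕ) : ℝ) + σ ^ 2) * (γ - 1)⁻¹) := by
  have hq := (qq_lim γ hγ p hnp hγlim).pull (fun n => mp4_X n (p n) (r n))
  have hb := (Pto.norm r (fun n => ((p n + r n : ℕ) : ℝ))
    (fun n => by exact_mod_cast (by omega : r n ≤ p n + r n))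
    (rp_le p r hnp)).pull (fun n => mp4_br n (p n) (r n))
  have hg := (Pto.norm (fun n => n) (fun n => (n : ℝ))
    (fun n => le_rfl) (fun n => le_rfl)).pull (fun n => mp4_g n (p n) (r n))
  have hg1 := hg.center (d := fun _ => 1) (by
    refine tendsto_const_nhds.congr' ?_
    filter_upwards [eventually_gt_atTop 0] with n hn
    have : (0 : ℝ) < n := by exact_mod_cast hn
    field_simp
    ring)
  have ht := hb.add (Pto.const _ (fun _ => σ ^ 2))
  have hs : ∀ n, 0 ≤ (r n / ((p n + r n : ℕ) : ℝ) + σ ^ 2) ∧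
      (r n / ((p n + r n : ℕ) : ℝ) + σ ^ 2) ≤ 1 + σ ^ 2 := by
    intro n
    refine ⟨by positivity, ?_⟩
    gcongr
    exact div_le_one_of_le₀ (by exact_mod_cast (by omega : r n ≤ p n + r n)) (by positivity)
  have hgq := hg1.mul hq (K := 1 + (γ - 1)⁻¹)
    (Eventually.of_forall fun n => by
      have : 0 < (γ - 1)⁻¹ := inv_pos.2 (by linarith)
      rw [abs_one]; linarith)
    (Eventually.of_forall fun n => by
      have : 0 < (γ - 1)⁻¹ := inv_pos.2 (by linarith)
      rw [abs_of_pos this]; linarith)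
  have hall := ht.mul hgq (K := max (1 + σ ^ 2) (γ - 1)⁻¹)
    (Eventually.of_forall fun n => by
      rw [abs_of_nonneg (hs n).1]
      exact (hs n).2.trans (le_max_left _ _))
    (Eventually.of_forall fun n => by
      have : 0 < (γ - 1)⁻¹ := inv_pos.2 (by linarith)
      rw [one_mul, abs_of_pos this]; exact le_max_right _ _)
  have hall2 : Pto (fun n => P4 n (p n) (r n))
    (fun n z => (ev σ (p n + r n) z.2.2 ⬝ᵥ ev σ (p n + r n) z.2.2) * qq z.1)
    (fun n => (r n / ((p n + r n : ℕ) : ℝ) + σ ^ 2) * (γ - 1)⁻¹) := by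
    simp only [one_mul] at hall
    refine hall.congr ?_
    filter_upwards [eventually_gt_atTop 0] with n hn
    refine ae_of_all _ fun z => ?_
    have : (0 : ℝ) < n := by exact_mod_cast hn
    simp only [ev_dot, tau2]
    field_simp
  intro ε hε
  refine (hall2 ε hε).congr' ?_
  filter_upwards [eventually_gt_atTop 0] with n hn
  have hv : Measurable (fun y : (Fin (p n) → ℝ) × ((Fin (r n) → ℝ) × (Fin n → ℝ)) =>
      ev σ (p n + r n) y.2) := (measurable_ev σ (p n + r n) n (r n)).comp measurable_snd
  exact (noise_law ((stdGaussianVec (p n)).prod ((stdGaussianVec (r n)).prod (stdGaussianVec n)))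
    n (p n) hn (fun y => ev σ (p n + r n) y.2) hv ε _).symm

end main

lemma cross_bound (n p r : ℕ) (v : (Fin r → ℝ) × (Fin n → ℝ) → Fin n → ℝ) (hv : Measurable v)
    {ε K : ℝ} (hε : 0 < ε) :
    P4 n p r {z | ε ≤ |z.2.1 ⬝ᵥ (RR z.1 *ᵥ v z.2.2)|} ≤
      P4 n p r {z | K ≤ (RR z.1 *ᵥ v z.2.2) ⬝ᵥ (RR z.1 *ᵥ v z.2.2)} +
      ENNReal.ofReal (K / ε ^ 2) := by
  have hs := mp_swap12 (stdGaussianMatrix n p) (stdGaussianVec p)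
      ((stdGaussianVec r).prod (stdGaussianVec n))
  have hw : Measurable (fun y : (Fin p → ℝ) × ((Fin n → Fin p → ℝ) × ((Fin r → ℝ) × (Fin n → ℝ))) =>
      RR y.2.1 *ᵥ v y.2.2) :=
    measurable_RRv (measurable_fst.comp measurable_snd)
      (hv.comp (measurable_snd.comp measurable_snd))
  have m1 : MeasurableSet {y : (Fin p → ℝ) × ((Fin n → Fin p → ℝ) × ((Fin r → ℝ) × (Fin n → ℝ))) |
      ε ≤ |y.1 ⬝ᵥ (RR y.2.1 *ᵥ v y.2.2)|} := by
    have := measurable_dot2 measurable_fst hw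
    exact measurableSet_le measurable_const this.abs
  have m2 : MeasurableSet {y : (Fin p → ℝ) × ((Fin n → Fin p → ℝ) × ((Fin r → ℝ) × (Fin n → ℝ))) |
      (RR y.2.1 *ᵥ v y.2.2) ⬝ᵥ (RR y.2.1 *ᵥ v y.2.2) < K} :=
    measurableSet_lt (measurable_dot2 hw hw) measurable_const
  have h2 := hs.measure_preimage_le ({y : (Fin p → ℝ) × ((Fin n → Fin p → ℝ) × ((Fin r → ℝ) × (Fin n → ℝ))) |
      ε ≤ |y.1 ⬝ᵥ (RR y.2.1 *ᵥ v y.2.2)|} ∩ {y | 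
      (RR y.2.1 *ᵥ v y.2.2) ⬝ᵥ (RR y.2.1 *ᵥ v y.2.2) < K})
  have h3 : ((stdGaussianVec p).prod ((stdGaussianMatrix n p).prod
      ((stdGaussianVec r).prod (stdGaussianVec n))))
      ({y : (Fin p → ℝ) × ((Fin n → Fin p → ℝ) × ((Fin r → ℝ) × (Fin n → ℝ))) |
      ε ≤ |y.1 ⬝ᵥ (RR y.2.1 *ᵥ v y.2.2)|} ∩ {y | 
      (RR y.2.1 *ᵥ v y.2.2) ⬝ᵥ (RR y.2.1 *ᵥ v y.2.2) < K}) ≤ ENNReal.ofReal (K / ε ^ 2) := by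
    refine sect_le _ _ (m1.inter m2) (ae_of_all _ fun y => ?_)
    by_cases hy : (RR y.1 *ᵥ v y.2) ⬝ᵥ (RR y.1 *ᵥ v y.2) < K
    · refine le_trans (measure_mono fun b hb => ?_) ((dot_cheb p (RR y.1 *ᵥ v y.2) hε).trans ?_)
      · exact hb.1
      · gcongr
    · refine le_trans (le_of_eq ?_) zero_le
      convert measure_empty (μ := stdGaussianVec p)
      ext b
      simp only [Set.mem_empty_iff_false, iff_false]
      intro hb
      exact hy hb.2
  refine le_trans (measure_mono ?_) ((measure_union_le _ _).trans
    (add_le_add_right (h2.trans h3) _))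
  intro z hz
  by_cases hK : K ≤ (RR z.1 *ᵥ v z.2.2) ⬝ᵥ (RR z.1 *ᵥ v z.2.2)
  · exact Or.inl hK
  · exact Or.inr ⟨hz, not_le.1 hK⟩

lemma BH_norm (σ : ℝ) (D n p r : ℕ)
    (z : (Fin n → Fin p → ℝ) × ((Fin p → ℝ) × ((Fin r → ℝ) × (Fin n → ℝ))))
    (h : ((of z.1) * (of z.1)ᵀ).det ≠ 0) :
    BH σ D z ⬝ᵥ BH σ D z = (z.2.1 ⬝ᵥ (PP z.1 *ᵥ z.2.1)) / (D : ℝ) +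
      ((z.2.1 ⬝ᵥ (RR z.1 *ᵥ ev σ D z.2.2)) / Real.sqrt D +
       (z.2.1 ⬝ᵥ (RR z.1 *ᵥ ev σ D z.2.2)) / Real.sqrt D) +
      (RR z.1 *ᵥ ev σ D z.2.2) ⬝ᵥ (RR z.1 *ᵥ ev σ D z.2.2) := by
  have e1 : BH σ D z = (1 / Real.sqrt D) • (PP z.1 *ᵥ z.2.1) + RR z.1 *ᵥ ev σ D z.2.2 := by
    rw [PP_mulVec, ← mulVec_smul, ← mulVec_add]
    simp only [BH, bh]
    congr 1
    funext i
    simp only [Pi.add_apply, Pi.smul_apply, smul_eq_mul, ev]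
    ring
  have e2 : ∀ w : Fin p → ℝ, (PP z.1 *ᵥ z.2.1) ⬝ᵥ w = z.2.1 ⬝ᵥ (PP z.1 *ᵥ w) := by
    intro w
    rw [dotProduct_mulVec, ← mulVec_transpose, PP_T]
  have e3 : (PP z.1 *ᵥ z.2.1) ⬝ᵥ (PP z.1 *ᵥ z.2.1) = z.2.1 ⬝ᵥ (PP z.1 *ᵥ z.2.1) := by
    rw [e2, mulVec_mulVec, PP_idem _ h]
  have e4 : (PP z.1 *ᵥ z.2.1) ⬝ᵥ (RR z.1 *ᵥ ev σ D z.2.2) =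
      z.2.1 ⬝ᵥ (RR z.1 *ᵥ ev σ D z.2.2) := by
    rw [e2, mulVec_mulVec, PP_RR _ h]
  have hD : Real.sqrt D * Real.sqrt D = D := Real.mul_self_sqrt (by positivity)
  rw [e1]
  simp only [add_dotProduct, dotProduct_add, smul_dotProduct, dotProduct_smul, smul_eq_mul, e3, e4,
    dotProduct_comm (RR z.1 *ᵥ ev σ D z.2.2) (PP z.1 *ᵥ z.2.1)]
  rw [mul_add, ← mul_assoc, div_mul_div_comm, hD]
  ring

section main
variable (σ : ℝ) (hσ : 0 < σ) (γ : ℝ) (hγ : 1 < γ) (p r : ℕ → ℕ) (hnp : ∀ n, n + 1 < p n)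
  (hγlim : Tendsto (fun n => (p n : ℝ) / n) atTop (𝓝 γ))

lemma s_bd (n : ℕ) : 0 ≤ (r n / ((p n + r n : ℕ) : ℝ)) ∧ (r n / ((p n + r n : ℕ) : ℝ)) ≤ 1 :=
  ⟨by positivity,
    div_le_one_of_le₀ (by exact_mod_cast (by omega : r n ≤ p n + r n)) (by positivity)⟩

include hσ hγ hnp hγlim

lemma A2_lim : Pto (fun n => P4 n (p n) (r n))
    (fun n z => (z.2.1 ⬝ᵥ (RR z.1 *ᵥ ev σ (p n + r n) z.2.2)) / Real.sqrt ((p n + r n : ℕ) : ℝ))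
    (fun _ => 0) := by
  have h3 := A3_lim σ hσ γ hγ p r hnp hγlim
  have hg : 0 < (γ - 1)⁻¹ := inv_pos.2 (by linarith)
  set K : ℝ := (1 + σ ^ 2) * (γ - 1)⁻¹ + 1 with hK
  intro ε hε
  have hlim : Tendsto (fun n : ℕ => ENNReal.ofReal (K / ε ^ 2 * (1 / (n : ℝ)))) atTop (𝓝 0) := by
    have := ENNReal.tendsto_ofReal
      ((tendsto_one_div_atTop_nhds_zero_nat (𝕜 := ℝ)).const_mul (K / ε ^ 2))
    simpa using this
  have hsum := (h3 1 one_pos).add hlim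
  rw [add_zero] at hsum
  refine tendsto_of_tendsto_of_tendsto_of_le_of_le' tendsto_const_nhds hsum
    (Eventually.of_forall fun _ => zero_le) ?_
  filter_upwards [eventually_gt_atTop 0] with n hn
  have hn' : (0 : ℝ) < n := by exact_mod_cast hn
  have hD := rp_le p r hnp n
  have hD0 : (0 : ℝ) < ((p n + r n : ℕ) : ℝ) := hn'.trans_le hD
  have hsD := Real.sqrt_pos.2 hD0
  have h := cross_bound n (p n) (r n) (fun y => ev σ (p n + r n) y)
    (measurable_ev σ (p n + r n) n (r n)) (ε := ε * Real.sqrt ((p n + r n : ℕ) : ℝ)) (K := K)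
    (by positivity)
  refine le_trans (measure_mono fun z hz => ?_) (h.trans (add_le_add (measure_mono fun z hz => ?_) ?_))
  · have hz' : ε ≤ |(z.2.1 ⬝ᵥ (RR z.1 *ᵥ ev σ (p n + r n) z.2.2)) /
      Real.sqrt ((p n + r n : ℕ) : ℝ) - 0| := hz
    rw [sub_zero, abs_div, abs_of_pos hsD, le_div_iff₀ hsD] at hz'
    exact hz'
  · have hz' : K ≤ (RR z.1 *ᵥ ev σ (p n + r n) z.2.2) ⬝ᵥ (RR z.1 *ᵥ ev σ (p n + r n) z.2.2) := hz
    have hs := s_bd p r n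
    have : (r n / ((p n + r n : ℕ) : ℝ) + σ ^ 2) * (γ - 1)⁻¹ ≤ (1 + σ ^ 2) * (γ - 1)⁻¹ := by
      gcongr; exact hs.2
    have hfin : (1 : ℝ) ≤ |(RR z.1 *ᵥ ev σ (p n + r n) z.2.2) ⬝ᵥ (RR z.1 *ᵥ ev σ (p n + r n) z.2.2)
        - (r n / ((p n + r n : ℕ) : ℝ) + σ ^ 2) * (γ - 1)⁻¹| :=
      le_trans (by linarith) (le_abs_self _)
    exact hfin
  · apply ENNReal.ofReal_le_ofReal
    rw [mul_pow, Real.sq_sqrt hD0.le, ← div_div, div_eq_mul_one_div (K / ε ^ 2)]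
    gcongr

/-- the limiting variance factor -/
noncomputable def cn (σ : ℝ) (n p r : ℕ) : ℝ :=
  n / ((p + r : ℕ) : ℝ) + (r / ((p + r : ℕ) : ℝ) + σ ^ 2) * (n / ((p : ℝ) - n - 1))

lemma N_lim : Pto (fun n => P4 n (p n) (r n))
    (fun n z => BH σ (p n + r n) z ⬝ᵥ BH σ (p n + r n) z) (fun n => cn σ n (p n) (r n)) := by
  have h1 := A1_lim p r hnp
  have h2 := A2_lim σ hσ γ hγ p r hnp hγlim
  have h3 := A3_lim σ hσ γ hγ p r hnp hγlim
  have h := (h1.add (h2.add h2)).add h3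
  have h' : Pto (fun n => P4 n (p n) (r n))
    (fun n z => BH σ (p n + r n) z ⬝ᵥ BH σ (p n + r n) z) _ := h.congr (by
      refine Eventually.of_forall fun n => ?_
      have := (mp4_X n (p n) (r n)).quasiMeasurePreserving.ae
        (gm_fullrank n (p n) (by have := hnp n; omega))
      filter_upwards [this] with z hz
      exact BH_norm σ (p n + r n) n (p n) (r n) z hz)
  refine h'.center ?_
  have hb := (lim_ratio2 γ hγ p hnp hγlim).const_sub ((γ - 1)⁻¹)
  rw [sub_self] at hb
  have hz := hb.abs
  rw [abs_zero] at hz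
  have hz2 := hz.const_mul (1 + σ ^ 2)
  rw [mul_zero] at hz2
  refine squeeze_zero_norm (fun n => ?_) hz2
  have hs := s_bd p r n
  have e : (n : ℝ) / ((p n + r n : ℕ) : ℝ) + (0 + 0) +
      (r n / ((p n + r n : ℕ) : ℝ) + σ ^ 2) * (γ - 1)⁻¹ - cn σ n (p n) (r n) =
      (r n / ((p n + r n : ℕ) : ℝ) + σ ^ 2) * ((γ - 1)⁻¹ - n / ((p n : ℝ) - n - 1)) := by
    unfold cn; ring
  rw [e, Real.norm_eq_abs, abs_mul, abs_of_nonneg (by have := hs.1; positivity)]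
  gcongr
  exact hs.2

lemma cn_lower : ∀ᶠ n in atTop, σ ^ 2 * (γ - 1)⁻¹ / 2 ≤ cn σ n (p n) (r n) := by
  have hg : 0 < (γ - 1)⁻¹ := inv_pos.2 (by linarith)
  have := (lim_ratio2 γ hγ p hnp hγlim).eventually (lt_mem_nhds (half_lt_self hg))
  filter_upwards [this] with n hn
  have hs := (s_bd p r n).1
  unfold cn
  have h1 : 0 ≤ (n : ℝ) / ((p n + r n : ℕ) : ℝ) := by positivity
  have h2 : σ ^ 2 * ((γ - 1)⁻¹ / 2) ≤ (r n / ((p n + r n : ℕ) : ℝ) + σ ^ 2) *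
      (n / ((p n : ℝ) - n - 1)) := by
    have : 0 < σ ^ 2 := by positivity
    apply mul_le_mul (by linarith) hn.le (by positivity) (by positivity)
  linarith

/-- the total law -/
noncomputable abbrev P5 (n p r : ℕ) := (P4 n p r).prod (stdGaussianVec p)

lemma cn_upper : ∃ K, ∀ᶠ n in atTop, |cn σ n (p n) (r n)| ≤ K := by
  have := (lim_ratio2 γ hγ p hnp hγlim).eventually (gt_mem_nhds (lt_add_one _))
  refine ⟨1 + (1 + σ ^ 2) * ((γ - 1)⁻¹ + 1), ?_⟩
  have hl := cn_lower σ hσ γ hγ p r hnp hγlim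
  have hg : 0 < (γ - 1)⁻¹ := inv_pos.2 (by linarith)
  filter_upwards [this, hl] with n hn hl
  have hp : 0 ≤ cn σ n (p n) (r n) := le_trans (by positivity) hl
  rw [abs_of_nonneg hp]
  unfold cn
  have hs := (s_bd p r n)
  have h2 : (n : ℝ) + 1 < p n := by exact_mod_cast hnp n
  have h3 : 0 ≤ n / ((p n : ℝ) - n - 1) := div_nonneg (by positivity) (by linarith)
  have h1 : (n : ℝ) / ((p n + r n : ℕ) : ℝ) ≤ 1 :=
    div_le_one_of_le₀ (rp_le p r hnp n) (by positivity)
  have h4 := hs.1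
  gcongr
  exact hs.2

lemma T2_lim : Pto (fun n => P5 n (p n) (r n))
    (fun n z => (BH σ (p n + r n) z.1 ⬝ᵥ BH σ (p n + r n) z.1) * (cn σ n (p n) (r n))⁻¹ *
      ((z.2 ⬝ᵥ z.2) / p n)⁻¹) (fun _ => 1) := by
  have hN := (N_lim σ hσ γ hγ p r hnp hγlim).pull
    (fun n => measurePreserving_fst (μ := P4 n (p n) (r n)) (ν := stdGaussianVec (p n)))
  have hh := (Pto.norm p (fun n => (p n : ℝ)) (fun n => le_rfl)
    (fun n => by exact_mod_cast (by have := hnp n; omega : n ≤ p n))).pull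
    (fun n => measurePreserving_snd (μ := P4 n (p n) (r n)) (ν := stdGaussianVec (p n)))
  have hp : ∀ n, (0 : ℝ) < p n := fun n => by exact_mod_cast (by have := hnp n; omega : 0 < p n)
  have hh1 : Pto (fun n => P5 n (p n) (r n)) (fun n z => (z.2 ⬝ᵥ z.2) / p n) (fun _ => 1) := by
    refine hh.center (tendsto_const_nhds.congr fun n => ?_)
    rw [div_self (hp n).ne', sub_self]
  have hh2 := hh1.inv (κ := 1) one_pos (Eventually.of_forall fun _ => le_rfl)
  obtain ⟨K, hK⟩ := cn_upper σ hσ γ hγ p r hnp hγlim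
  have hl := cn_lower σ hσ γ hγ p r hnp hγlim
  have hg : 0 < (γ - 1)⁻¹ := inv_pos.2 (by linarith)
  set κ := σ ^ 2 * (γ - 1)⁻¹ / 2 with hκ
  have hκ0 : 0 < κ := by positivity
  have hc := Pto.const (fun n => P5 n (p n) (r n)) (fun n => (cn σ n (p n) (r n))⁻¹)
  have hNc := hN.mul hc (K := max K κ⁻¹) (hK.mono fun n h => h.trans (le_max_left _ _))
    (hl.mono fun n h => by
      rw [abs_of_nonneg (inv_nonneg.2 (hκ0.le.trans h))]
      exact (inv_anti₀ hκ0 h).trans (le_max_right _ _))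
  have hNc1 := hNc.center (d := fun _ => 1) (tendsto_const_nhds.congr' (by
    filter_upwards [hl] with n h
    rw [mul_inv_cancel₀ (hκ0.trans_le h).ne', sub_self]))
  have hf := hNc1.mul hh2 (K := 1) (Eventually.of_forall fun _ => by simp)
    (Eventually.of_forall fun _ => by simp)
  simpa using hf

end main

/-- Slutsky -/
lemma slutsky {Ω : ℕ → Type*} [∀ n, MeasurableSpace (Ω n)] (μ : ∀ n, Measure (Ω n))
    [∀ n, IsProbabilityMeasure (μ n)] (G T : ∀ n, Ω n → ℝ)
    (hG : ∀ᶠ n in atTop, MeasurePreserving (G n) (μ n) (gaussianReal 0 1))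
    (hTm : ∀ n, Measurable (T n)) (hT : Pto μ T (fun _ => 1))
    (f : ℝ → ℝ) (C : ℝ) (hC : ∀ x y, dist (f x) (f y) ≤ C) (L : ℝ≥0) (hL : LipschitzWith L f) :
    Tendsto (fun n => ∫ ω, f (T n ω * G n ω) ∂(μ n)) atTop (𝓝 (∫ t, f t ∂(gaussianReal 0 1))) := by
  have hC0 : 0 ≤ C := dist_nonneg.trans (hC 0 0)
  have hbd : ∀ x, ‖f x‖ ≤ ‖f 0‖ + C := fun x => by
    have := hC x 0
    rw [dist_eq_norm] at this
    calc ‖f x‖ = ‖f 0 + (f x - f 0)‖ := by ring_nf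
      _ ≤ _ := norm_add_le _ _
      _ ≤ _ := by gcongr
  have hfc := hL.continuous
  -- bound
  have hkey : ∀ ε > 0, ∀ K > 0, ∀ n, MeasurePreserving (G n) (μ n) (gaussianReal 0 1) →
      |∫ ω, f (T n ω * G n ω) ∂(μ n) - ∫ t, f t ∂(gaussianReal 0 1)| ≤
      L * (ε * K) + C * (μ n).real {ω | ε ≤ |T n ω - 1|} +
        C * (gaussianReal 0 1).real {t | K ≤ |t|} := by
    intro ε hε K hK n hGn
    have mT : MeasurableSet {ω | ε ≤ |T n ω - 1|} := meas_dev (hTm n) ε 1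
    have mK : MeasurableSet {t : ℝ | K ≤ |t|} := measurableSet_le measurable_const (by fun_prop)
    have mG : MeasurableSet {ω | K ≤ |G n ω|} := hGn.measurable mK
    have e1 : ∫ t, f t ∂(gaussianReal 0 1) = ∫ ω, f (G n ω) ∂(μ n) := by
      rw [← hGn.map_eq, integral_map hGn.measurable.aemeasurable hfc.aestronglyMeasurable]
    have hGm := hGn.measurable
    have hTm' := hTm n
    have i1 : Integrable (fun ω => f (T n ω * G n ω)) (μ n) :=
      Integrable.of_bound (hfc.measurable.comp (hTm'.mul hGm)).aestronglyMeasurable _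
        (ae_of_all _ fun ω => hbd _)
    have i2 : Integrable (fun ω => f (G n ω)) (μ n) :=
      Integrable.of_bound (hfc.measurable.comp hGm).aestronglyMeasurable _
        (ae_of_all _ fun ω => hbd _)
    have e2 : (gaussianReal 0 1).real {t | K ≤ |t|} = (μ n).real {ω | K ≤ |G n ω|} := by
      rw [← hGn.measureReal_preimage mK.nullMeasurableSet]; rfl
    have j1 : Integrable (({ω | ε ≤ |T n ω - 1|}).indicator (fun _ => C)) (μ n) :=
      (integrable_const C).indicator mT
    have j2 : Integrable (({ω | K ≤ |G n ω|}).indicator (fun _ => C)) (μ n) :=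
      (integrable_const C).indicator mG
    rw [e1, e2, ← integral_sub i1 i2]
    calc |∫ ω, (f (T n ω * G n ω) - f (G n ω)) ∂(μ n)|
        ≤ ∫ ω, |f (T n ω * G n ω) - f (G n ω)| ∂(μ n) := abs_integral_le_integral_abs
      _ ≤ ∫ ω, ((L * (ε * K) + ({ω | ε ≤ |T n ω - 1|}).indicator (fun _ => C) ω) +
          ({ω | K ≤ |G n ω|}).indicator (fun _ => C) ω) ∂(μ n) := by
          refine integral_mono (i1.sub i2).abs (((integrable_const _).add j1).add j2) fun ω => ?_
          have hd := hC (T n ω * G n ω) (G n ω)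
          rw [Real.dist_eq] at hd
          have hn1 : 0 ≤ ({ω | ε ≤ |T n ω - 1|}).indicator (fun _ => C) ω :=
            Set.indicator_nonneg (fun _ _ => hC0) _
          have hn2 : 0 ≤ ({ω | K ≤ |G n ω|}).indicator (fun _ => C) ω :=
            Set.indicator_nonneg (fun _ _ => hC0) _
          have hp : 0 ≤ (L : ℝ) * (ε * K) := by positivity
          simp only
          by_cases h1 : ε ≤ |T n ω - 1|
          · have : ({ω | ε ≤ |T n ω - 1|}).indicator (fun _ => C) ω = C :=
              Set.indicator_of_mem (s := {ω | ε ≤ |T n ω - 1|}) h1 _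
            linarith
          by_cases h2 : K ≤ |G n ω|
          · have : ({ω | K ≤ |G n ω|}).indicator (fun _ => C) ω = C :=
              Set.indicator_of_mem (s := {ω | K ≤ |G n ω|}) h2 _
            linarith
          · push Not at h1 h2
            have h3 := hL.dist_le_mul (T n ω * G n ω) (G n ω)
            rw [Real.dist_eq, Real.dist_eq] at h3
            have h4 : |T n ω * G n ω - G n ω| ≤ ε * K := by
              rw [show T n ω * G n ω - G n ω = (T n ω - 1) * G n ω by ring, abs_mul]
              gcongr
            have h5 : (L : ℝ) * |T n ω * G n ω - G n ω| ≤ L * (ε * K) := by gcongr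
            linarith
      _ = _ := by
          have j3 : Integrable (fun ω => (L : ℝ) * (ε * K) +
            ({ω | ε ≤ |T n ω - 1|}).indicator (fun _ => C) ω) (μ n) := (integrable_const _).add j1
          rw [integral_add j3 j2, integral_add (integrable_const _) j1,
            integral_indicator_const _ mT, integral_indicator_const _ mG]
          simp [mul_comm]
  -- tail
  have htail : Tendsto (fun k : ℕ => (gaussianReal 0 1).real {t : ℝ | ((k : ℝ) + 1) ≤ |t|}) atTop
      (𝓝 0) := by
    have hb : ∀ k : ℕ, (gaussianReal 0 1).real {t : ℝ | ((k : ℝ) + 1) ≤ |t|} ≤ 1 / ((k : ℝ) + 1) := by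
      intro k
      have hk : (0 : ℝ) < (k : ℝ) + 1 := by positivity
      have h2 := meas_ge_le_variance_div_sq (μ := gaussianReal 0 1) (X := id)
        (memLp_id_gaussianReal' 2 (by simp)) hk
      rw [variance_id_gaussianReal] at h2
      simp only [id, integral_id_gaussianReal, sub_zero] at h2
      have h3 := ENNReal.toReal_mono (by simp) h2
      rw [ENNReal.toReal_ofReal (by positivity)] at h3
      refine h3.trans ?_
      rw [NNReal.coe_one, div_le_div_iff₀ (by positivity) hk]
      nlinarith
    exact squeeze_zero (fun _ => measureReal_nonneg) hb tendsto_one_div_add_atTop_nhds_zero_nat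
  rw [Metric.tendsto_atTop']
  intro η hη
  have ht2 := htail.const_mul C
  rw [mul_zero] at ht2
  obtain ⟨k, hk⟩ := (ht2.eventually (gt_mem_nhds (by positivity : 0 < η / 3))).exists
  have hK : (0 : ℝ) < (k : ℝ) + 1 := by positivity
  set ε : ℝ := η / 3 / ((L + 1) * ((k : ℝ) + 1)) with hε
  have hε0 : 0 < ε := by positivity
  have hLe : L * (ε * ((k : ℝ) + 1)) ≤ η / 3 := by
    have : (L : ℝ) * (ε * ((k : ℝ) + 1)) = η / 3 * (L / (L + 1)) := by rw [hε]; field_simp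
    rw [this]
    have h1 : (L : ℝ) / (L + 1) ≤ 1 := div_le_one_of_le₀ (by linarith) (by positivity)
    nlinarith
  have hT1 : Tendsto (fun n => C * (μ n).real {ω | ε ≤ |T n ω - 1|}) atTop (𝓝 0) := by
    have := (ENNReal.tendsto_toReal ENNReal.zero_ne_top).comp (hT ε hε0)
    have := this.const_mul C
    simpa [Measure.real] using this
  have hT2 := hT1.eventually (gt_mem_nhds (by positivity : 0 < η / 3))
  obtain ⟨N, hN⟩ := eventually_atTop.1 (hT2.and hG)
  refine ⟨N, fun n hn => ?_⟩
  obtain ⟨h1, h2⟩ := hN n hn.le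
  rw [Real.dist_eq]
  have := hkey ε hε0 _ hK n h2
  linarith

lemma pred_law (σ : ℝ) (n p r D : ℕ) (hD : D = p + r) (hn : n ≤ p) (hp : 0 < p) (hpD : p ≤ D)
    (x₀ : Fin D → ℝ) (s : ℝ) (f : ℝ → ℝ) (hf : Continuous f) :
    ∫ ω : (Fin n → Fin D → ℝ) × (Fin D → ℝ) × (Fin n → ℝ),
      f (minNormPrediction σ n p D hpD x₀ ω / s)
      ∂((stdGaussianMatrix n D).prod ((stdGaussianVec D).prod (stdGaussianVec n)))
    = ∫ z, f ((Real.sqrt (∑ j : Fin p, x₀ (Fin.castLE hpD j) ^ 2) / Real.sqrt (z.2 ⬝ᵥ z.2) *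
        Real.sqrt (BH σ (p + r) z.1 ⬝ᵥ BH σ (p + r) z.1) / s) * (e0 p ⬝ᵥ z.2)) ∂(P5 n p r) := by
  subst hD
  set x : Fin p → ℝ := fun j => x₀ (Fin.castLE hpD j) with hx
  have hxx : ∑ j : Fin p, x₀ (Fin.castLE hpD j) ^ 2 = x ⬝ᵥ x := by
    simp [dotProduct, hx, pow_two]
  have h1 := mnp_ae σ n p r hn hpD x₀
  have h2 := mnp_law σ n p r x
  have h3 := sphere_trick (P4 n p r) p hp (BH σ (p + r)) (measurable_BH σ (p + r) n p r)
    (fun x y h => BH_dot_law σ (p + r) n p r x y h) x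
  rw [h3] at h2
  have hfs : Continuous (fun t => f (t / s)) := hf.comp (continuous_id.div_const s)
  have hBm : Measurable (fun z : ((Fin n → Fin p → ℝ) × ((Fin p → ℝ) × ((Fin r → ℝ) × (Fin n → ℝ)))) × (Fin p → ℝ) =>
      BH σ (p + r) z.1) := (measurable_BH σ (p + r) n p r).comp measurable_fst
  have hd : Measurable (fun z : ((Fin n → Fin p → ℝ) × ((Fin p → ℝ) × ((Fin r → ℝ) × (Fin n → ℝ)))) × (Fin p → ℝ) =>
      Real.sqrt (x ⬝ᵥ x) / Real.sqrt (z.2 ⬝ᵥ z.2) *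
        (Real.sqrt (BH σ (p + r) z.1 ⬝ᵥ BH σ (p + r) z.1) * (e0 p ⬝ᵥ z.2))) :=
    (measurable_const.div (measurable_dot2 measurable_snd measurable_snd).sqrt).mul
      ((measurable_dot2 hBm hBm).sqrt.mul ((measurable_dotp _).comp measurable_snd))
  have e1 : ∫ ω, f (minNormPrediction σ n p (p + r) hpD x₀ ω / s)
      ∂((stdGaussianMatrix n (p + r)).prod ((stdGaussianVec (p + r)).prod (stdGaussianVec n)))
      = ∫ ω, f (mnp σ n p r x ω / s)
      ∂((stdGaussianMatrix n (p + r)).prod ((stdGaussianVec (p + r)).prod (stdGaussianVec n))) := by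
    refine integral_congr_ae ?_
    filter_upwards [h1] with ω hω
    rw [hω]
  have e2 := integral_map (μ := (stdGaussianMatrix n (p + r)).prod
    ((stdGaussianVec (p + r)).prod (stdGaussianVec n))) (measurable_mnp σ n p r x).aemeasurable
    (f := fun t => f (t / s)) hfs.aestronglyMeasurable
  have e3 := integral_map (μ := P5 n p r) hd.aemeasurable
    (f := fun t => f (t / s)) hfs.aestronglyMeasurable
  rw [e1, ← e2, h2, e3, hxx]
  refine integral_congr_ae (ae_of_all _ fun z => ?_)
  simp only
  congr 1
  ring

/-- **Asymptotic Gaussianity of the non-member prediction (m = 0).**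
In the Gaussian linear regression setting with `n + 1 < p ≤ D`, `p/n → γ ∈ (1, ∞)`,
and deterministic test points `x₀` with `‖x₀,ₚ‖²/p` converging to a positive limit,
the min-norm least squares prediction `ŷ₀ = x₀,ₚᵀXₚ†y` at a fresh (non-member) test
point satisfies: the law of `ŷ₀/σ₀` converges weakly to `N(0,1)`, where
`σ₀² = (n/p)(1/D + (1 + σ² − p/D)/(p − n − 1))‖x₀,ₚ‖²`. -/
theorem nonmember_prediction_asymptotically_gaussian
    (σ : ℝ) (hσ : 0 < σ) (γ : ℝ) (hγ : 1 < γ)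
    (p D : ℕ → ℕ) (hnp : ∀ n, n + 1 < p n) (hpD : ∀ n, p n ≤ D n)
    (hγlim : Filter.Tendsto (fun n => (p n : ℝ) / n) Filter.atTop (nhds γ))
    (x₀ : (n : ℕ) → Fin (D n) → ℝ) (r : ℝ) (hr : 0 < r)
    (hx₀ : Filter.Tendsto
      (fun n => (∑ j : Fin (p n), x₀ n (Fin.castLE (hpD n) j) ^ 2) / p n)
      Filter.atTop (nhds r))
    (σ₀ : ℕ → ℝ)
    (hσ₀ : ∀ n, σ₀ n = Real.sqrt (((n : ℝ) / p n) *
      (1 / D n + (1 + σ ^ 2 - (p n : ℝ) / D n) / ((p n : ℝ) - n - 1)) *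
      (∑ j : Fin (p n), x₀ n (Fin.castLE (hpD n) j) ^ 2))) :
    ∀ f : BoundedContinuousFunction ℝ ℝ,
      Filter.Tendsto
        (fun n => ∫ ω : (Fin n → Fin (D n) → ℝ) × (Fin (D n) → ℝ) × (Fin n → ℝ),
          f (minNormPrediction σ n (p n) (D n) (hpD n) (x₀ n) ω / σ₀ n)
          ∂((stdGaussianMatrix n (D n)).prod
              ((stdGaussianVec (D n)).prod (stdGaussianVec n))))
        Filter.atTop (nhds (∫ t, f t ∂(gaussianReal 0 1))) := by
  have hpos : ∀ n, 0 < p n := fun n => by have := hnp n; omega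
  set rr : ℕ → ℕ := fun n => D n - p n with hrr
  have hD : ∀ n, D n = p n + rr n := fun n => by have := hpD n; simp only [hrr]; omega
  set xx : ℕ → ℝ := fun n => ∑ j : Fin (p n), x₀ n (Fin.castLE (hpD n) j) ^ 2 with hxx
  have hxpos : ∀ᶠ n in atTop, 0 < xx n := by
    filter_upwards [hx₀.eventually (lt_mem_nhds hr)] with n hn
    have hp : (0 : ℝ) < p n := by exact_mod_cast hpos n
    exact (div_pos_iff_of_pos_right hp).1 hn
  have hg : 0 < (γ - 1)⁻¹ := inv_pos.2 (by linarith)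
  have hcpos : ∀ᶠ n in atTop, 0 < cn σ n (p n) (rr n) := by
    filter_upwards [cn_lower σ hσ γ hγ p rr hnp hγlim] with n hn
    exact lt_of_lt_of_le (by positivity) hn
  have hs0 : ∀ n, σ₀ n = Real.sqrt (cn σ n (p n) (rr n) / p n * xx n) := by
    intro n
    rw [hσ₀ n]
    congr 2
    have hp : (0 : ℝ) < p n := by exact_mod_cast hpos n
    have hDn : ((p n + rr n : ℕ) : ℝ) = D n := by rw [hD n]
    have hD0 : (0 : ℝ) < D n := hp.trans_le (by exact_mod_cast hpD n)
    have hrn : (rr n : ℝ) = D n - p n := by rw [← hDn]; push_cast; ring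
    have h2 : (n : ℝ) + 1 < p n := by exact_mod_cast hnp n
    have h3 : (p n : ℝ) - n - 1 ≠ 0 := by
      intro h; linarith
    unfold cn
    rw [hDn, hrn]
    field_simp
    ring
  set T : ∀ n, (((Fin n → Fin (p n) → ℝ) × ((Fin (p n) → ℝ) × ((Fin (rr n) → ℝ) × (Fin n → ℝ)))) ×
      (Fin (p n) → ℝ)) → ℝ := fun n z =>
    Real.sqrt (xx n) / Real.sqrt (z.2 ⬝ᵥ z.2) *
        Real.sqrt (BH σ (p n + rr n) z.1 ⬝ᵥ BH σ (p n + rr n) z.1) / σ₀ n with hTdef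
  have hTm : ∀ n, Measurable (T n) := by
    intro n
    have hBm : Measurable (fun z : (((Fin n → Fin (p n) → ℝ) × ((Fin (p n) → ℝ) ×
        ((Fin (rr n) → ℝ) × (Fin n → ℝ)))) × (Fin (p n) → ℝ)) => BH σ (p n + rr n) z.1) :=
      (measurable_BH σ (p n + rr n) n (p n) (rr n)).comp measurable_fst
    exact ((measurable_const.div (measurable_dot2 measurable_snd measurable_snd).sqrt).mul
      (measurable_dot2 hBm hBm).sqrt).div measurable_const
  have hT : Pto (fun n => P5 n (p n) (rr n)) T (fun _ => 1) := by
    refine (T2_lim σ hσ γ hγ p rr hnp hγlim).comb1 fun ε hε => ⟨ε, hε, ?_⟩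
    filter_upwards [hxpos, hcpos] with n hx hc
    refine ae_of_all _ fun z hz => ?_
    have hp : (0 : ℝ) < p n := by exact_mod_cast hpos n
    have hT0 : 0 ≤ T n z := by
      simp only [hTdef]
      have : 0 ≤ σ₀ n := by rw [hs0]; positivity
      positivity
    have hT2 : T n z ^ 2 = (BH σ (p n + rr n) z.1 ⬝ᵥ BH σ (p n + rr n) z.1) *
        (cn σ n (p n) (rr n))⁻¹ * ((z.2 ⬝ᵥ z.2) / p n)⁻¹ := by
      simp only [hTdef]
      rw [div_pow, mul_pow, div_pow, Real.sq_sqrt hx.le, Real.sq_sqrt (dot_nonneg _),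
        Real.sq_sqrt (dot_nonneg _), hs0, Real.sq_sqrt (by positivity), inv_div]
      field_simp
    rw [← hT2] at hz
    refine lt_of_le_of_lt ?_ hz
    have e : T n z ^ 2 - 1 = (T n z - 1) * (T n z + 1) := by ring
    rw [e, abs_mul, abs_of_nonneg (by linarith : 0 ≤ T n z + 1)]
    nlinarith [abs_nonneg (T n z - 1)]
  have hG : ∀ n, MeasurePreserving (fun z : (((Fin n → Fin (p n) → ℝ) × ((Fin (p n) → ℝ) ×
        ((Fin (rr n) → ℝ) × (Fin n → ℝ)))) × (Fin (p n) → ℝ)) => e0 (p n) ⬝ᵥ z.2)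
      (P5 n (p n) (rr n)) (gaussianReal 0 1) := by
    intro n
    have h1 := gv_dot (p n) (e0 (p n))
    rw [e0_dot (p n) (hpos n), Real.toNNReal_one] at h1
    exact h1.comp measurePreserving_snd
  have hYm : ∀ n, Measurable (fun z => T n z * (e0 (p n) ⬝ᵥ z.2)) := fun n =>
    (hTm n).mul (hG n).measurable
  let νs : ℕ → ProbabilityMeasure ℝ := fun n =>
    ⟨(P5 n (p n) (rr n)).map (fun z => T n z * (e0 (p n) ⬝ᵥ z.2)),
      Measure.isProbabilityMeasure_map (hYm n).aemeasurable⟩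
  let ν : ProbabilityMeasure ℝ := ⟨gaussianReal 0 1, inferInstance⟩
  have hνint : ∀ (f : ℝ → ℝ), Continuous f → ∀ n, ∫ t, f t ∂(νs n : Measure ℝ) =
      ∫ z, f (T n z * (e0 (p n) ⬝ᵥ z.2)) ∂(P5 n (p n) (rr n)) := fun f hf n =>
    integral_map (hYm n).aemeasurable hf.aestronglyMeasurable
  have hconv : Tendsto νs atTop (𝓝 ν) := by
    rw [tendsto_iff_forall_lipschitz_integral_tendsto]
    rintro f ⟨C, hC⟩ ⟨L, hL⟩
    have h := slutsky (fun n => P5 n (p n) (rr n)) (fun n z => e0 (p n) ⬝ᵥ z.2) T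
      (Eventually.of_forall hG) hTm hT f C hC L hL
    exact h.congr fun n => (hνint f hL.continuous n).symm
  intro f
  have h := (ProbabilityMeasure.tendsto_iff_forall_integral_tendsto.1 hconv) f
  refine h.congr fun n => ?_
  rw [hνint f f.continuous n]
  exact (pred_law σ n (p n) (rr n) (D n) (hD n) (by have := hnp n; omega) (hpos n) (hpD n)
    (x₀ n) (σ₀ n) f f.continuous).symm
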